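/- arXiv:1709.00228 — 6 statements merged into one kernel-verified Lean document; each statement's English description precedes it below -/
import Mathlib

section
/- Let d ≥ 1, let X_1, …, X_d be measurable spaces, and for each i ∈ {1,…,d} let D_i and D̂_i be probability measures on X_i. Let f : X_1 × ⋯ × X_d → ℝ be measurable and bounded, and let ε ≥ 0. Suppose that for every i ∈ {1,…,d} and every a_{−i} ∈ ∏_{j≠i} X_j one has |∫ f(x_i ; a_{−i}) dD_i(x_i) − ∫ f(x_i ; a_{−i}) dD̂_i(x_i)| ≤ ε, where (x_i ; a_{−i}) denotes the point of ∏_j X_j whose i-th coordinate is x_i and whose j-th coordinate is a_j for each j ≠ i. Then |∫ f d(∏_{i=1}^d D_i) − ∫ f d(∏_{i=1}^d D̂_i)| ≤ d·ε. -/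
open MeasureTheory

theorem pi_map_update_aux {d : ℕ} {X : Fin d → Type*} [∀ i, MeasurableSpace (X i)]
    (μ ν : ∀ i, Measure (X i))
    [∀ i, IsProbabilityMeasure (μ i)] [∀ i, IsProbabilityMeasure (ν i)]
    (i : Fin d) (h : ∀ j, j ≠ i → μ j = ν j) :
    Measure.pi ν = ((Measure.pi μ).prod (ν i)).map
      (fun p : (∀ j, X j) × X i => Function.update p.1 i p.2) := by
  have hm : Measurable (fun p : (∀ j, X j) × X i => Function.update p.1 i p.2) :=
    measurable_update'
  refine Measure.pi_eq fun s hs => ?_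
  rw [Measure.map_apply hm (MeasurableSet.univ_pi hs)]
  have hpre : (fun p : (∀ j, X j) × X i => Function.update p.1 i p.2) ⁻¹' (Set.univ.pi s)
      = (Set.univ.pi (Function.update s i Set.univ)) ×ˢ s i := by
    ext p
    simp only [Set.mem_preimage, Set.mem_pi, Set.mem_univ, true_imp_iff, Set.mem_prod]
    constructor
    · intro hp
      refine ⟨fun j => ?_, by simpa using hp i⟩
      by_cases hj : j = i
      · subst hj; simp
      · simpa [hj] using hp j
    · rintro ⟨h1, h2⟩ j
      by_cases hj : j = i
      · subst hj; simpa using h2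
      · simpa [hj] using h1 j
  rw [hpre, Measure.prod_prod, Measure.pi_pi,
    ← Finset.mul_prod_erase Finset.univ _ (Finset.mem_univ i),
    ← Finset.mul_prod_erase Finset.univ (fun j => ν j (s j)) (Finset.mem_univ i)]
  have : ∏ x ∈ Finset.univ.erase i, μ x (Function.update s i Set.univ x)
      = ∏ x ∈ Finset.univ.erase i, ν x (s x) := by
    refine Finset.prod_congr rfl fun j hj => ?_
    have hj' := Finset.ne_of_mem_erase hj
    rw [Function.update_of_ne hj', h j hj']
  rw [this]
  simp [mul_comm]

theorem pi_step_aux {d : ℕ} {X : Fin d → Type*} [∀ i, MeasurableSpace (X i)]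
    (μ ν : ∀ i, Measure (X i))
    [∀ i, IsProbabilityMeasure (μ i)] [∀ i, IsProbabilityMeasure (ν i)]
    (f : (∀ i, X i) → ℝ) (hf : Measurable f) (hbdd : ∃ C, ∀ x, |f x| ≤ C)
    (ε : ℝ) (i : Fin d) (h : ∀ j, j ≠ i → μ j = ν j)
    (hs : ∀ a : ∀ j, X j, |(∫ x, f (Function.update a i x) ∂(μ i)) -
        ∫ x, f (Function.update a i x) ∂(ν i)| ≤ ε) :
    |(∫ x, f x ∂(Measure.pi μ)) - ∫ x, f x ∂(Measure.pi ν)| ≤ ε := by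
  obtain ⟨C, hC⟩ := hbdd
  have hm : Measurable (fun p : (∀ j, X j) × X i => Function.update p.1 i p.2) :=
    measurable_update'
  have hint : ∀ κ : Measure (X i), IsProbabilityMeasure κ →
      Integrable (fun p : (∀ j, X j) × X i => f (Function.update p.1 i p.2))
        ((Measure.pi μ).prod κ) := fun κ _ =>
    Integrable.of_bound (hf.comp hm).aestronglyMeasurable C
      (Filter.Eventually.of_forall fun p => hC _)
  have e : ∀ κ : ∀ i, Measure (X i), (∀ i, IsProbabilityMeasure (κ i)) →
      (∀ j, j ≠ i → μ j = κ j) → ∫ x, f x ∂(Measure.pi κ) =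
        ∫ a, ∫ x, f (Function.update a i x) ∂(κ i) ∂(Measure.pi μ) := by
    intro κ _ hκ
    rw [pi_map_update_aux μ κ i hκ, integral_map hm.aemeasurable hf.aestronglyMeasurable,
      integral_prod _ (hint _ inferInstance)]
  rw [e μ inferInstance (fun _ _ => rfl), e ν inferInstance h,
    ← integral_sub (hint _ inferInstance).integral_prod_left
      (hint _ inferInstance).integral_prod_left]
  have := norm_integral_le_of_norm_le_const (μ := Measure.pi μ) (C := ε)
    (f := fun a => (∫ x, f (Function.update a i x) ∂(μ i)) -
        ∫ x, f (Function.update a i x) ∂(ν i))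
    (Filter.Eventually.of_forall hs)
  simpa using this


/-- If `f` is a bounded measurable function on a product of `d` measurable
spaces and, for every coordinate `i` and every fixing `a` of the other coordinates, the
one-dimensional integrals of `f` along coordinate `i` under `D i` and `Dhat i` differ by at
most `ε`, then the integrals of `f` under the two product measures differ by at most `d * ε`. -/
theorem product_integral_stability
    {d : ℕ} (hd : 1 ≤ d) {X : Fin d → Type*} [∀ i, MeasurableSpace (X i)]
    (D Dhat : ∀ i, Measure (X i))
    [∀ i, IsProbabilityMeasure (D i)] [∀ i, IsProbabilityMeasure (Dhat i)]
    (f : (∀ i, X i) → ℝ) (hf : Measurable f) (hbdd : ∃ C, ∀ x, |f x| ≤ C)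
    (ε : ℝ) (hε : 0 ≤ ε)
    (hslice : ∀ (i : Fin d) (a : ∀ j, X j),
      |(∫ x, f (Function.update a i x) ∂(D i)) -
        ∫ x, f (Function.update a i x) ∂(Dhat i)| ≤ ε) :
    |(∫ x, f x ∂(Measure.pi D)) - ∫ x, f x ∂(Measure.pi Dhat)| ≤ d * ε := by
  classical
  have key : ∀ s : Finset (Fin d),
      |(∫ x, f x ∂(Measure.pi (fun j => if j ∈ s then D j else Dhat j)))
        - ∫ x, f x ∂(Measure.pi Dhat)| ≤ s.card * ε := by
    intro s
    induction s using Finset.induction_on with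
    | empty => simp
    | insert i s hi ih =>
      have inst : ∀ t : Finset (Fin d), ∀ j,
          IsProbabilityMeasure (if j ∈ t then D j else Dhat j) := by
        intro t j; split_ifs <;> infer_instance
      have := inst s
      have := inst (insert i s)
      have st := pi_step_aux (fun j => if j ∈ insert i s then D j else Dhat j)
        (fun j => if j ∈ s then D j else Dhat j) f hf hbdd ε i
        (fun j hj => by simp [hj]) (fun a => by simpa [hi] using hslice i a)
      rw [Finset.card_insert_of_notMem hi]
      push_cast
      refine (abs_sub_le _ _ _).trans ((add_le_add st ih).trans ?_)
      linarith
  simpa using key Finset.univ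
end

section
/- Let d, ℓ ≥ 1, let X_1,…,X_d be measurable spaces, let D_i be a probability measure on X_i for each i, and let ε, δ > 0. Let H be a set of bounded measurable functions f : ∏_{i=1}^d X_i → ℝ. For each i, let P_i be a map from ℓ-tuples of points of X_i to probability measures on X_i, and suppose there is a measurable set G_i ⊆ (X_i)^ℓ with D_i^{⊗ℓ}(G_i) ≥ 1 − δ/d such that for every z ∈ G_i, every f ∈ H, and every a_{−i} ∈ ∏_{j≠i} X_j, |∫ f(x_i ; a_{−i}) d(P_i(z))(x_i) − ∫ f(x_i ; a_{−i}) dD_i(x_i)| ≤ ε/d. Then there is a measurable set G ⊆ (∏_{i=1}^d X_i)^ℓ with (∏_{i=1}^d D_i)^{⊗ℓ}(G) ≥ 1 − δ such that for every sample sequence (z^{(1)},…,z^{(ℓ)}) ∈ G and every f ∈ H, |∫ f d(∏_{i=1}^d P_i(z_i^{(1)},…,z_i^{(ℓ)})) − ∫ f d(∏_{i=1}^d D_i)| ≤ ε, where z_i^{(t)} denotes the i-th coordinate of z^{(t)}. -/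
open MeasureTheory

lemma map_update_pi {d : ℕ} {X : Fin d → Type*} [∀ i, MeasurableSpace (X i)]
    (μ : ∀ i, Measure (X i)) [∀ i, IsProbabilityMeasure (μ i)] (i : Fin d)
    (ν : Measure (X i)) [IsProbabilityMeasure ν]
    (μ' : ∀ i, Measure (X i)) [∀ i, IsProbabilityMeasure (μ' i)]
    (hi : μ' i = ν) (hj : ∀ j, j ≠ i → μ' j = μ j) :
    ((Measure.pi μ).prod ν).map (fun p => Function.update p.1 i p.2) = Measure.pi μ' := by
  have hm : Measurable (fun p : (∀ j, X j) × X i => Function.update p.1 i p.2) := by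
    rw [measurable_pi_iff]
    intro j
    by_cases h : j = i
    · subst h; simpa using measurable_snd
    · simp only [Function.update_of_ne h]
      exact (measurable_pi_apply j).comp measurable_fst
  symm
  apply Measure.pi_eq
  intro s hs
  rw [Measure.map_apply hm (MeasurableSet.univ_pi hs)]
  have : (fun p : (∀ j, X j) × X i => Function.update p.1 i p.2) ⁻¹' (Set.univ.pi s)
      = (Set.univ.pi (Function.update s i Set.univ)) ×ˢ (s i) := by
    ext ⟨a, x⟩
    simp only [Set.mem_preimage, Set.mem_pi, Set.mem_univ, true_imp_iff, Set.mem_prod]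
    constructor
    · intro h
      refine ⟨fun j => ?_, by simpa using h i⟩
      by_cases hji : j = i
      · subst hji; simp
      · simpa [hji] using h j
    · rintro ⟨h, hx⟩ j
      by_cases hji : j = i
      · subst hji; simpa using hx
      · simpa [hji] using h j
  rw [this, Measure.prod_prod, Measure.pi_pi,
    ← Finset.mul_prod_erase Finset.univ _ (Finset.mem_univ i),
    ← Finset.mul_prod_erase Finset.univ (fun j => μ' j (s j)) (Finset.mem_univ i)]
  simp only [Function.update_self, measure_univ, one_mul, hi]
  rw [mul_comm]
  congr 1
  apply Finset.prod_congr rfl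
  intro j hj'
  have hne := Finset.ne_of_mem_erase hj'
  rw [Function.update_of_ne hne, hj j hne]

lemma integral_update_pi {d : ℕ} {X : Fin d → Type*} [∀ i, MeasurableSpace (X i)]
    (μ : ∀ i, Measure (X i)) [∀ i, IsProbabilityMeasure (μ i)] (i : Fin d)
    (ν : Measure (X i)) [IsProbabilityMeasure ν]
    (μ' : ∀ i, Measure (X i)) [∀ i, IsProbabilityMeasure (μ' i)]
    (hi : μ' i = ν) (hj : ∀ j, j ≠ i → μ' j = μ j)
    (f : (∀ i, X i) → ℝ) (hf : Measurable f) (hb : ∃ C, ∀ x, |f x| ≤ C) :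
    Integrable (fun a => ∫ x, f (Function.update a i x) ∂ν) (Measure.pi μ) ∧
    ∫ x, f x ∂(Measure.pi μ') =
      ∫ a, ∫ x, f (Function.update a i x) ∂ν ∂(Measure.pi μ) := by
  obtain ⟨C, hC⟩ := hb
  have hm : Measurable (fun p : (∀ j, X j) × X i => Function.update p.1 i p.2) := by
    rw [measurable_pi_iff]
    intro j
    by_cases h : j = i
    · subst h; simpa using measurable_snd
    · simp only [Function.update_of_ne h]
      exact (measurable_pi_apply j).comp measurable_fst
  have hint : Integrable (fun p : (∀ j, X j) × X i => f (Function.update p.1 i p.2))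
      ((Measure.pi μ).prod ν) :=
    Integrable.of_bound (hf.comp hm).aestronglyMeasurable C
      (Filter.Eventually.of_forall fun p => hC _)
  refine ⟨hint.integral_prod_left, ?_⟩
  rw [← map_update_pi μ i ν μ' hi hj, integral_map hm.aemeasurable hf.aestronglyMeasurable,
    integral_prod _ hint]

lemma hybrid_step {d : ℕ} {X : Fin d → Type*} [∀ i, MeasurableSpace (X i)]
    (μ : ∀ i, Measure (X i)) [∀ i, IsProbabilityMeasure (μ i)] (i : Fin d)
    (μ' : ∀ i, Measure (X i)) [∀ i, IsProbabilityMeasure (μ' i)]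
    (hj : ∀ j, j ≠ i → μ' j = μ j)
    (f : (∀ i, X i) → ℝ) (hf : Measurable f) (hb : ∃ C, ∀ x, |f x| ≤ C) (c : ℝ)
    (h : ∀ a, |(∫ x, f (Function.update a i x) ∂(μ' i)) -
        ∫ x, f (Function.update a i x) ∂(μ i)| ≤ c) :
    |(∫ x, f x ∂(Measure.pi μ')) - ∫ x, f x ∂(Measure.pi μ)| ≤ c := by
  obtain ⟨h1, e1⟩ := integral_update_pi μ i (μ' i) μ' rfl hj f hf hb
  obtain ⟨h2, e2⟩ := integral_update_pi μ i (μ i) μ rfl (fun _ _ => rfl) f hf hb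
  rw [e1, e2, ← integral_sub h1 h2]
  have := norm_integral_le_of_norm_le_const (μ := Measure.pi μ) (C := c)
    (f := fun a => (∫ x, f (Function.update a i x) ∂(μ' i)) -
        ∫ x, f (Function.update a i x) ∂(μ i))
    (Filter.Eventually.of_forall h)
  simpa using this

lemma hybrid {d : ℕ} {X : Fin d → Type*} [∀ i, MeasurableSpace (X i)]
    (μ ν : ∀ i, Measure (X i)) [∀ i, IsProbabilityMeasure (μ i)]
    [∀ i, IsProbabilityMeasure (ν i)]
    (f : (∀ i, X i) → ℝ) (hf : Measurable f) (hb : ∃ C, ∀ x, |f x| ≤ C) (c : ℝ)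
    (h : ∀ i a, |(∫ x, f (Function.update a i x) ∂(ν i)) -
        ∫ x, f (Function.update a i x) ∂(μ i)| ≤ c) (s : Finset (Fin d)) :
    |(∫ x, f x ∂(Measure.pi (fun i => if i ∈ s then ν i else μ i))) -
      ∫ x, f x ∂(Measure.pi μ)| ≤ s.card * c := by
  have inst : ∀ s : Finset (Fin d), ∀ i,
      IsProbabilityMeasure ((fun i => if i ∈ s then ν i else μ i) i) := by
    intro s i
    dsimp only
    split_ifs <;> infer_instance
  induction s using Finset.induction_on with
  | empty => simp
  | insert i s his ih =>
    have := inst s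
    have := inst (insert i s)
    have key := hybrid_step (fun j => if j ∈ s then ν j else μ j) i
      (fun j => if j ∈ insert i s then ν j else μ j)
      (fun j hj => by simp [hj]) f hf hb c (fun a => by simpa [his] using h i a)
    rw [Finset.card_insert_of_notMem his]
    push_cast
    have := abs_sub_le (∫ x, f x ∂(Measure.pi (fun j => if j ∈ insert i s then ν j else μ j)))
      (∫ x, f x ∂(Measure.pi (fun j => if j ∈ s then ν j else μ j))) (∫ x, f x ∂(Measure.pi μ))
    linarith

/-- Per-coordinate processings `P i`, each mapping `ℓ` i.i.d. samples from
`D i` to a probability measure that `ε/d`-approximates `D i` on every one-dimensional slice of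
every `f ∈ H` (with success probability `1 - δ/d`), yield, with probability `1 - δ` over `ℓ`
i.i.d. samples from the product measure, a product of processed distributions that
`ε`-approximates the product measure simultaneously for all `f ∈ H`. -/
theorem uniform_convergence_product_measure
    {d ℓ : ℕ} (hd : 1 ≤ d) (hℓ : 1 ≤ ℓ)
    {X : Fin d → Type*} [∀ i, MeasurableSpace (X i)]
    (D : ∀ i, Measure (X i)) [∀ i, IsProbabilityMeasure (D i)]
    (ε δ : ℝ) (hε : 0 < ε) (hδ : 0 < δ)
    (H : Set ((∀ i, X i) → ℝ))
    (hH : ∀ f ∈ H, Measurable f ∧ ∃ C, ∀ x, |f x| ≤ C)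
    (P : ∀ i, (Fin ℓ → X i) → ProbabilityMeasure (X i))
    (G : ∀ i, Set (Fin ℓ → X i))
    (hGmeas : ∀ i, MeasurableSet (G i))
    (hGbig : ∀ i, ENNReal.ofReal (1 - δ / d) ≤ Measure.pi (fun _ : Fin ℓ => D i) (G i))
    (hgood : ∀ i, ∀ z ∈ G i, ∀ f ∈ H, ∀ a : ∀ j, X j,
      |(∫ x, f (Function.update a i x) ∂((P i z : Measure (X i)))) -
        ∫ x, f (Function.update a i x) ∂(D i)| ≤ ε / d) :
    ∃ G' : Set (Fin ℓ → ∀ i, X i), MeasurableSet G' ∧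
      ENNReal.ofReal (1 - δ) ≤ Measure.pi (fun _ : Fin ℓ => Measure.pi D) G' ∧
      ∀ z ∈ G', ∀ f ∈ H,
        |(∫ x, f x ∂(Measure.pi (fun i => (P i (fun t => z t i) : Measure (X i))))) -
          ∫ x, f x ∂(Measure.pi D)| ≤ ε := by
  have hd0 : (0 : ℝ) < d := by exact_mod_cast hd
  have hmp : ∀ i, MeasurePreserving (fun (z : Fin ℓ → ∀ i, X i) (t : Fin ℓ) => z t i)
      (Measure.pi (fun _ : Fin ℓ => Measure.pi D)) (Measure.pi (fun _ : Fin ℓ => D i)) :=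
    fun i => measurePreserving_pi _ _ (fun _ => measurePreserving_eval D i)
  have hms : ∀ i, MeasurableSet ((fun (z : Fin ℓ → ∀ i, X i) (t : Fin ℓ) => z t i) ⁻¹' G i) :=
    fun i => (hmp i).measurable (hGmeas i)
  have hM : MeasurableSet (⋂ i, (fun (z : Fin ℓ → ∀ i, X i) (t : Fin ℓ) => z t i) ⁻¹' G i) :=
    MeasurableSet.iInter hms
  refine ⟨⋂ i, (fun (z : Fin ℓ → ∀ i, X i) (t : Fin ℓ) => z t i) ⁻¹' G i, hM, ?_, ?_⟩
  · have hc : Measure.pi (fun _ : Fin ℓ => Measure.pi D)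
        (⋂ i, (fun (z : Fin ℓ → ∀ i, X i) (t : Fin ℓ) => z t i) ⁻¹' G i)ᶜ ≤
        ENNReal.ofReal δ := by
      rw [Set.compl_iInter]
      refine (measure_iUnion_fintype_le _ _).trans ?_
      have : ∀ i, Measure.pi (fun _ : Fin ℓ => Measure.pi D)
          ((fun (z : Fin ℓ → ∀ i, X i) (t : Fin ℓ) => z t i) ⁻¹' G i)ᶜ ≤
          ENNReal.ofReal (δ / d) := by
        intro i
        rw [prob_compl_eq_one_sub (hms i), (hmp i).measure_preimage (hGmeas i).nullMeasurableSet,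
          tsub_le_iff_right]
        refine le_trans ?_ (add_le_add_right (hGbig i) _)
        refine le_trans ?_ ENNReal.ofReal_add_le
        simp
      refine (Finset.sum_le_sum fun i _ => this i).trans ?_
      rw [Finset.sum_const, Finset.card_univ, Fintype.card_fin, nsmul_eq_mul,
        ← ENNReal.ofReal_natCast, ← ENNReal.ofReal_mul hd0.le, mul_div_cancel₀ _ hd0.ne']
    rw [ENNReal.ofReal_sub _ hδ.le, ENNReal.ofReal_one, tsub_le_iff_right,
      ← prob_add_prob_compl (μ := Measure.pi (fun _ : Fin ℓ => Measure.pi D)) hM]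
    gcongr
  · intro z hz f hf
    rw [Set.mem_iInter] at hz
    have := hybrid D (fun i => (P i (fun t => z t i) : Measure (X i))) f (hH f hf).1 (hH f hf).2
      (ε / d) (fun i a => hgood i _ (hz i) f hf a) Finset.univ
    simp only [Finset.mem_univ, if_true, Finset.card_univ, Fintype.card_fin] at this
    rwa [mul_div_cancel₀ _ hd0.ne'] at this
end

section
/- Let d, ℓ ≥ 1, let X_1,…,X_d be measurable spaces, let D_i be a probability measure on X_i for each i, let ε, δ > 0, and let T_1 ⊔ T_2 ⊔ ⋯ ⊔ T_k = {1,…,d} be a partition. Let H be a set of bounded measurable functions f : ∏_{i=1}^d X_i → ℝ. For each block j ∈ {1,…,k}, let P_j be a map from ℓ-tuples of points of ∏_{i∈T_j} X_i to probability measures on ∏_{i∈T_j} X_i, and suppose there is a measurable set G_j ⊆ (∏_{i∈T_j} X_i)^ℓ with (∏_{i∈T_j} D_i)^{⊗ℓ}(G_j) ≥ 1 − δ/k such that for every z ∈ G_j, every f ∈ H, and every fixing a of the coordinates outside T_j, |∫ f(x_{T_j} ; a) d(P_j(z))(x_{T_j}) − ∫ f(x_{T_j} ; a) d(∏_{i∈T_j}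 D_i)(x_{T_j})| ≤ ε/k. Then there is a measurable set G ⊆ (∏_{i=1}^d X_i)^ℓ with (∏_{i=1}^d D_i)^{⊗ℓ}(G) ≥ 1 − δ such that for every sample sequence (z^{(1)},…,z^{(ℓ)}) ∈ G and every f ∈ H, |∫ f d(∏_{j=1}^k P_j(z_{T_j}^{(1)},…,z_{T_j}^{(ℓ)})) − ∫ f d(∏_{i=1}^d D_i)| ≤ ε, where z_{T_j}^{(t)} denotes the restriction of z^{(t)} to the coordinates in T_j and the product over blocks is identified with a measure on ∏_{i=1}^d X_i via the natural measurable isomorphism ∏_{j=1}^k ∏_{i∈T_j} X_i ≅ ∏_{i=1}^d X_i. -/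
open MeasureTheory

/-- Replacing one factor of a product measure. -/
lemma ucp_map_update {ι : Type*} [Fintype ι] [DecidableEq ι] {Y : ι → Type*}
    [∀ j, MeasurableSpace (Y j)] (m : ∀ j, Measure (Y j)) [∀ j, IsProbabilityMeasure (m j)]
    (j : ι) (κ : Measure (Y j)) [IsProbabilityMeasure κ] (m' : ∀ j, Measure (Y j))
    [∀ j, IsProbabilityMeasure (m' j)] (h1 : m' j = κ) (h2 : ∀ i, i ≠ j → m' i = m i) :
    Measure.map (fun p : (∀ j, Y j) × Y j => Function.update p.1 j p.2)
      ((Measure.pi m).prod κ) = Measure.pi m' := by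
  have hmeas : Measurable (fun p : (∀ j, Y j) × Y j => Function.update p.1 j p.2) := by
    exact measurable_update'
  symm
  apply Measure.pi_eq
  intro s hs
  rw [Measure.map_apply hmeas (MeasurableSet.univ_pi hs)]
  have hpre : (fun p : (∀ j, Y j) × Y j => Function.update p.1 j p.2) ⁻¹' (Set.univ.pi s)
      = (Set.univ.pi (Function.update s j Set.univ)) ×ˢ (s j) := by
    ext p
    simp only [Set.mem_preimage, Set.mem_pi, Set.mem_univ, true_imp_iff, Set.mem_prod]
    constructor
    · intro h
      refine ⟨fun i => ?_, by simpa using h j⟩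
      by_cases hi : i = j
      · subst hi; simp
      · simpa [hi] using h i
    · rintro ⟨h, h'⟩ i
      by_cases hi : i = j
      · subst hi; simpa using h'
      · simpa [hi] using h i
  rw [hpre, Measure.prod_prod, Measure.pi_pi, ← Finset.mul_prod_erase _ _ (Finset.mem_univ j),
    ← Finset.mul_prod_erase (Finset.univ) (fun i => m' i (s i)) (Finset.mem_univ j)]
  simp only [Function.update_self, measure_univ, one_mul, h1]
  rw [mul_comm]
  congr 1
  apply Finset.prod_congr rfl
  intro i hi
  have hi' := Finset.ne_of_mem_erase hi
  rw [h2 i hi', Function.update_of_ne hi']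

lemma ucp_integral_update {ι : Type*} [Fintype ι] [DecidableEq ι] {Y : ι → Type*}
    [∀ j, MeasurableSpace (Y j)] (m : ∀ j, Measure (Y j)) [∀ j, IsProbabilityMeasure (m j)]
    (j : ι) (κ : Measure (Y j)) [IsProbabilityMeasure κ] (m' : ∀ j, Measure (Y j))
    [∀ j, IsProbabilityMeasure (m' j)] (h1 : m' j = κ) (h2 : ∀ i, i ≠ j → m' i = m i)
    (F : (∀ j, Y j) → ℝ) (hF : Measurable F) (C : ℝ) (hC : ∀ x, |F x| ≤ C) :
    Integrable (fun b => ∫ y, F (Function.update b j y) ∂κ) (Measure.pi m) ∧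
    ∫ x, F x ∂(Measure.pi m') = ∫ b, ∫ y, F (Function.update b j y) ∂κ ∂(Measure.pi m) := by
  have hmeas : Measurable (fun p : (∀ j, Y j) × Y j => Function.update p.1 j p.2) := by
    exact measurable_update'
  have hint : Integrable (fun p : (∀ j, Y j) × Y j => F (Function.update p.1 j p.2))
      ((Measure.pi m).prod κ) :=
    Integrable.of_bound (hF.comp hmeas).aestronglyMeasurable C
      (Filter.Eventually.of_forall fun p => hC _)
  refine ⟨hint.integral_prod_left, ?_⟩
  rw [← ucp_map_update m j κ m' h1 h2, integral_map hmeas.aemeasurable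
    hF.aestronglyMeasurable, integral_prod _ hint]

/-- The hybrid argument. -/
lemma ucp_hybrid {ι : Type*} [Fintype ι] [DecidableEq ι] {Y : ι → Type*}
    [∀ j, MeasurableSpace (Y j)] (μ ν : ∀ j, Measure (Y j)) [∀ j, IsProbabilityMeasure (μ j)]
    [∀ j, IsProbabilityMeasure (ν j)]
    (F : (∀ j, Y j) → ℝ) (hF : Measurable F) (C : ℝ) (hC : ∀ x, |F x| ≤ C) (η : ℝ)
    (h : ∀ j, ∀ b : ∀ j, Y j, |∫ y, F (Function.update b j y) ∂(μ j)
      - ∫ y, F (Function.update b j y) ∂(ν j)| ≤ η) :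
    |∫ x, F x ∂(Measure.pi μ) - ∫ x, F x ∂(Measure.pi ν)| ≤ Fintype.card ι * η := by
  have hp : ∀ (S : Finset ι) j, IsProbabilityMeasure (if j ∈ S then μ j else ν j) := by
    intro S j; split_ifs <;> infer_instance
  have key : ∀ S : Finset ι, |∫ x, F x ∂(Measure.pi fun j => if j ∈ S then μ j else ν j)
      - ∫ x, F x ∂(Measure.pi ν)| ≤ S.card * η := by
    intro S
    induction S using Finset.induction_on with
    | empty => simp
    | insert j S hj ih =>
      obtain ⟨i1, e1⟩ := ucp_integral_update (fun i => if i ∈ S then μ i else ν i) j (μ j)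
        (fun i => if i ∈ insert j S then μ i else ν i) (by simp)
        (by intro i hi; simp [hi]) F hF C hC
      obtain ⟨i2, e2⟩ := ucp_integral_update (fun i => if i ∈ S then μ i else ν i) j (ν j)
        (fun i => if i ∈ S then μ i else ν i) (by simp [hj])
        (by intro i hi; rfl) F hF C hC
      have e3 : |∫ x, F x ∂(Measure.pi fun i => if i ∈ insert j S then μ i else ν i)
          - ∫ x, F x ∂(Measure.pi fun i => if i ∈ S then μ i else ν i)| ≤ η := by
        rw [e1, e2, ← integral_sub i1 i2]
        have := norm_integral_le_of_norm_le_const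
          (μ := Measure.pi fun i => if i ∈ S then μ i else ν i)
          (f := fun b => ∫ y, F (Function.update b j y) ∂(μ j)
            - ∫ y, F (Function.update b j y) ∂(ν j)) (C := η)
          (Filter.Eventually.of_forall fun b => h j b)
        simpa using this
      rw [Finset.card_insert_of_notMem hj]
      push_cast
      calc _ ≤ _ := abs_sub_le _ (∫ x, F x ∂(Measure.pi fun i => if i ∈ S then μ i else ν i)) _
        _ ≤ η + S.card * η := add_le_add e3 ih
        _ = _ := by ring
  simpa using key Finset.univ

lemma ucp_map_blocks {d k : ℕ} {X : Fin d → Type*} [∀ i, MeasurableSpace (X i)]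
    (D : ∀ i, Measure (X i)) [∀ i, IsProbabilityMeasure (D i)] (blk : Fin d → Fin k) :
    Measure.map
      (fun (y : ∀ j : Fin k, ∀ i : {i // blk i = j}, X i) (i : Fin d) => y (blk i) ⟨i, rfl⟩)
      (Measure.pi fun j => Measure.pi (fun i : {i // blk i = j} => D i)) = Measure.pi D := by
  symm
  apply Measure.pi_eq
  intro s hs
  rw [Measure.map_apply (by fun_prop) (MeasurableSet.univ_pi hs)]
  have hpre : (fun (y : ∀ j : Fin k, ∀ i : {i // blk i = j}, X i) (i : Fin d) =>
      y (blk i) ⟨i, rfl⟩) ⁻¹' (Set.univ.pi s)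
      = Set.univ.pi fun j => Set.univ.pi fun i : {i // blk i = j} => s i := by
    ext y
    simp only [Set.mem_preimage, Set.mem_pi, Set.mem_univ, true_imp_iff]
    constructor
    · rintro h j ⟨i, rfl⟩
      exact h i
    · intro h i
      exact h (blk i) ⟨i, rfl⟩
  rw [hpre]
  simp only [Measure.pi_pi]
  exact Fintype.prod_fiberwise blk fun i => D i (s i)

lemma ucp_restrict {d k : ℕ} {X : Fin d → Type*} [∀ i, MeasurableSpace (X i)]
    (D : ∀ i, Measure (X i)) [∀ i, IsProbabilityMeasure (D i)] (blk : Fin d → Fin k) (ℓ : ℕ)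
    (j : Fin k) :
    MeasurePreserving (fun (z : Fin ℓ → ∀ i, X i) t (i : {i // blk i = j}) => z t i)
      (Measure.pi fun _ => Measure.pi D)
      (Measure.pi fun _ => Measure.pi (fun i : {i // blk i = j} => D i)) := by
  refine measurePreserving_pi (fun _ => Measure.pi D)
    (fun _ => Measure.pi (fun i : {i // blk i = j} => D i))
    (f := fun _ x (i : {i // blk i = j}) => x i) (fun _ => ?_)
  exact measurePreserving_fst.comp (measurePreserving_piEquivPiSubtypeProd D (fun i => blk i = j))

/-- Partitioned uniform convergence under product measures: per-block
processings `P j`, each mapping `ℓ` i.i.d. samples of the block marginal to a probability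
measure that `ε/k`-approximates the block marginal on every slice of every `f ∈ H` obtained by
fixing the coordinates outside the block (with success probability `1 - δ/k`), yield, with
probability `1 - δ` over `ℓ` i.i.d. samples from the full product measure, a product over
blocks of processed distributions (transported to the full product space along the natural
identification) that `ε`-approximates the full product measure for all `f ∈ H` simultaneously.
The partition `T₁ ⊔ ⋯ ⊔ T_k = [d]` is encoded by the surjection `blk : Fin d → Fin k`,
with blocks `T j = {i | blk i = j}`. -/
theorem uniform_convergence_product_measure_partition
    {d ℓ k : ℕ} (hd : 1 ≤ d) (hℓ : 1 ≤ ℓ) (hk : 1 ≤ k)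
    {X : Fin d → Type*} [∀ i, MeasurableSpace (X i)]
    (D : ∀ i, Measure (X i)) [∀ i, IsProbabilityMeasure (D i)]
    (ε δ : ℝ) (hε : 0 < ε) (hδ : 0 < δ)
    (blk : Fin d → Fin k) (hblk : Function.Surjective blk)
    (H : Set ((∀ i, X i) → ℝ))
    (hH : ∀ f ∈ H, Measurable f ∧ ∃ C, ∀ x, |f x| ≤ C)
    (P : ∀ j : Fin k,
      (Fin ℓ → (∀ i : {i // blk i = j}, X i)) → ProbabilityMeasure (∀ i : {i // blk i = j}, X i))
    (G : ∀ j : Fin k, Set (Fin ℓ → (∀ i : {i // blk i = j}, X i)))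
    (hGmeas : ∀ j, MeasurableSet (G j))
    (hGbig : ∀ j, ENNReal.ofReal (1 - δ / k) ≤
      Measure.pi (fun _ : Fin ℓ => Measure.pi (fun i : {i // blk i = j} => D i)) (G j))
    (hgood : ∀ j, ∀ z ∈ G j, ∀ f ∈ H, ∀ a : ∀ i, X i,
      |(∫ (x : ∀ i : {i // blk i = j}, X i),
          f (fun i => if h : blk i = j then x ⟨i, h⟩ else a i) ∂((P j z : Measure _))) -
        ∫ (x : ∀ i : {i // blk i = j}, X i),
          f (fun i => if h : blk i = j then x ⟨i, h⟩ else a i)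
          ∂(Measure.pi (fun i : {i // blk i = j} => D i))| ≤ ε / k) :
    ∃ G' : Set (Fin ℓ → ∀ i, X i), MeasurableSet G' ∧
      ENNReal.ofReal (1 - δ) ≤ Measure.pi (fun _ : Fin ℓ => Measure.pi D) G' ∧
      ∀ z ∈ G', ∀ f ∈ H,
        |(∫ x, f x ∂(Measure.map
            (fun (y : ∀ j : Fin k, ∀ i : {i // blk i = j}, X i) (i : Fin d) => y (blk i) ⟨i, rfl⟩)
            (Measure.pi (fun j => (P j (fun t (i : {i // blk i = j}) => z t i) : Measure _))))) -
          ∫ x, f x ∂(Measure.pi D)| ≤ ε := by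
  refine ⟨⋂ j, (fun (z : Fin ℓ → ∀ i, X i) t (i : {i // blk i = j}) => z t i) ⁻¹' G j,
    ?_, ?_, ?_⟩
  · exact MeasurableSet.iInter fun j => (ucp_restrict D blk ℓ j).measurable (hGmeas j)
  · have hk0 : (0 : ℝ) < k := by exact_mod_cast hk
    have hm : ∀ j, MeasurableSet
        ((fun (z : Fin ℓ → ∀ i, X i) t (i : {i // blk i = j}) => z t i) ⁻¹' G j) :=
      fun j => (ucp_restrict D blk ℓ j).measurable (hGmeas j)
    have hc : ∀ j, (Measure.pi (fun _ : Fin ℓ => Measure.pi D)).real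
        ((fun (z : Fin ℓ → ∀ i, X i) t (i : {i // blk i = j}) => z t i) ⁻¹' G j)ᶜ ≤ δ / k := by
      intro j
      rw [probReal_compl_eq_one_sub (hm j)]
      have := hGbig j
      rw [← (ucp_restrict D blk ℓ j).measure_preimage (hGmeas j).nullMeasurableSet,
        ENNReal.ofReal_le_iff_le_toReal (measure_ne_top _ _)] at this
      simp only [Measure.real]
      linarith
    rw [ENNReal.ofReal_le_iff_le_toReal (measure_ne_top _ _)]
    have h1 := probReal_compl_eq_one_sub
      (μ := Measure.pi (fun _ : Fin ℓ => Measure.pi D)) (MeasurableSet.iInter hm)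
    have h2 : (Measure.pi (fun _ : Fin ℓ => Measure.pi D)).real
        (⋂ j, (fun (z : Fin ℓ → ∀ i, X i) t (i : {i // blk i = j}) => z t i) ⁻¹' G j)ᶜ ≤ δ := by
      rw [Set.compl_iInter]
      calc _ ≤ _ := measureReal_iUnion_fintype_le _
        _ ≤ ∑ _j : Fin k, δ / k := Finset.sum_le_sum fun j _ => hc j
        _ = δ := by simp; field_simp
    simp only [Measure.real] at h1 h2
    linarith
  · intro z hz f hf
    have hk0 : (k : ℝ) ≠ 0 := by
      have : k ≠ 0 := by omega
      exact_mod_cast this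
    obtain ⟨hfm, C, hC⟩ := hH f hf
    have he : Measurable (fun (y : ∀ j : Fin k, ∀ i : {i // blk i = j}, X i) (i : Fin d) =>
      y (blk i) ⟨i, rfl⟩) := by fun_prop
    rw [← ucp_map_blocks D blk, integral_map he.aemeasurable hfm.aestronglyMeasurable,
      integral_map he.aemeasurable hfm.aestronglyMeasurable]
    have := ucp_hybrid
      (fun j => (P j (fun t (i : {i // blk i = j}) => z t i) : Measure _))
      (fun j => Measure.pi (fun i : {i // blk i = j} => D i))
      (fun y => f (fun i => y (blk i) ⟨i, rfl⟩)) (hfm.comp he) C (fun _ => hC _) (ε / k) ?_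
    · rw [Fintype.card_fin, mul_div_cancel₀ _ hk0] at this
      exact this
    · intro j b
      have hu : ∀ y : (∀ i : {i // blk i = j}, X i),
          (fun i => Function.update b j y (blk i) ⟨i, rfl⟩) =
          (fun i => if h : blk i = j then y ⟨i, h⟩ else b (blk i) ⟨i, rfl⟩ : ∀ i, X i) := by
        intro y
        funext i
        by_cases h : blk i = j
        · subst h; simp
        · simp [h]
      simp only [hu]
      exact hgood j _ (Set.mem_iInter.1 hz j) f hf (fun i => b (blk i) ⟨i, rfl⟩)
end

section
/- There is an absolute constant c > 0 with the following property. For every ℓ ≥ 1, every ε, δ ∈ (0,1), every integer k ≥ c·(ℓ²/ε²)·log(2ℓ/δ), and all probability measures D_1,…,D_ℓ on ℝ: there is a measurable set of sample sequences (x^{(1)},…,x^{(k)}) ∈ (ℝ^ℓ)^k of (∏_{i=1}^ℓ D_i)^{⊗k}-measure at least 1 − δ on which the following holds: letting D̂_i be the empirical distribution assigning mass 1/k to each of x_i^{(1)},…,x_i^{(k)} (where x_i^{(t)} is the i-th coordinate of x^{(t)}), for every Borel single-intersecting set E ⊆ ℝ^ℓ one has |(∏_{i=1}^ℓ D̂_i)(E)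 − (∏_{i=1}^ℓ D_i)(E)| ≤ ε. -/
open MeasureTheory
open scoped ENNReal

/-- A set `E ⊆ ℝ^ℓ` is *single-intersecting* if its intersection with every axis-parallel
line is order-connected (an interval, possibly empty, a point, or unbounded). -/
def SingleIntersecting {ℓ : ℕ} (E : Set (Fin ℓ → ℝ)) : Prop :=
  ∀ (i : Fin ℓ) (a : Fin ℓ → ℝ), ({x : ℝ | Function.update a i x ∈ E}).OrdConnected

/-- The empirical distribution of the sample `x : Fin k → ℝ`, assigning mass `1/k` to each
sample point. -/
noncomputable def empiricalMeasure (k : ℕ) (x : Fin k → ℝ) : Measure ℝ :=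
  (k : ℝ≥0∞)⁻¹ • ∑ t : Fin k, Measure.dirac (x t)

instance empiricalMeasure.isFiniteMeasure (k : ℕ) (x : Fin k → ℝ) :
    IsFiniteMeasure (empiricalMeasure k x) := by
  constructor
  rw [empiricalMeasure, Measure.smul_apply, Measure.finset_sum_apply]
  simp only [measure_univ, Finset.sum_const, Finset.card_univ, Fintype.card_fin,
    nsmul_eq_mul, mul_one, smul_eq_mul]
  rcases Nat.eq_zero_or_pos k with hk | hk
  · subst hk; simp
  · rw [ENNReal.inv_mul_cancel (by exact_mod_cast hk.ne') (by simp)]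
    exact ENNReal.one_lt_top


namespace SIProof

/-- sign of a boolean -/
noncomputable def sg (b : Bool) : ℝ := if b then 1 else -1

/-- indicator of `x ≤ t` -/
noncomputable def ind (t x : ℝ) : ℝ := if x ≤ t then 1 else 0

open Classical in
lemma card_half {ι : Type*} [Fintype ι] [DecidableEq ι] (i0 : ι) (b : Bool)
    (Q : (ι → Bool) → Prop) (hQ : ∀ σ c, Q (Function.update σ i0 c) ↔ Q σ) :
    2 * ((Finset.univ.filter (fun σ : ι → Bool => σ i0 = b ∧ Q σ)).card : ℝ) =
      ((Finset.univ.filter (fun σ : ι → Bool => Q σ)).card : ℝ) := by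
  have h1 : (Finset.univ.filter (fun σ : ι → Bool => Q σ)).card =
      (Finset.univ.filter (fun σ : ι → Bool => σ i0 = b ∧ Q σ)).card +
      (Finset.univ.filter (fun σ : ι → Bool => σ i0 = !b ∧ Q σ)).card := by
    rw [← Finset.card_union_of_disjoint]
    · congr 1
      ext σ
      simp only [Finset.mem_filter, Finset.mem_univ, true_and, Finset.mem_union]
      cases h : σ i0 <;> cases b <;> simp
    · rw [Finset.disjoint_left]
      intro σ h h'
      simp only [Finset.mem_filter, Finset.mem_univ, true_and] at h h'
      have := h.1.symm.trans h'.1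
      cases b <;> simp at this
  have h2 : (Finset.univ.filter (fun σ : ι → Bool => σ i0 = b ∧ Q σ)).card =
      (Finset.univ.filter (fun σ : ι → Bool => σ i0 = !b ∧ Q σ)).card := by
    refine Finset.card_bij' (fun σ _ => Function.update σ i0 (!b))
      (fun σ _ => Function.update σ i0 b) ?_ ?_ ?_ ?_
    · intro σ h
      simp only [Finset.mem_filter, Finset.mem_univ, true_and] at h ⊢
      exact ⟨by simp, (hQ _ _).2 h.2⟩
    · intro σ h
      simp only [Finset.mem_filter, Finset.mem_univ, true_and] at h ⊢
      exact ⟨by simp, (hQ _ _).2 h.2⟩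
    · intro σ h
      simp only [Finset.mem_filter, Finset.mem_univ, true_and] at h
      simp [← h.1]
    · intro σ h
      simp only [Finset.mem_filter, Finset.mem_univ, true_and] at h
      simp [← h.1]
  rw [h1, ← h2]; push_cast; ring

open Classical in
/-- Doob-type maximal inequality for signed sums along a sorted order. -/
lemma sign_max {ι : Type*} [Fintype ι] [DecidableEq ι] (x : ι → ℝ) (lam u e : ℝ) (hl : 0 ≤ lam)
    (he : e = 1 ∨ e = -1) (A : Finset ι) : ∀ s : ℝ,
    ((Finset.univ.filter (fun σ : ι → Bool =>
      ∃ t, u ≤ s + ∑ i ∈ A, e * sg (σ i) * ind t (x i))).card : ℝ) ≤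
      2 ^ (Fintype.card ι) * (Real.exp (lam * (s - u)) * Real.cosh lam ^ A.card) := by
  have htriv : ∀ (Q : (ι → Bool) → Prop), 
      ((Finset.univ.filter (fun σ : ι → Bool => Q σ)).card : ℝ) ≤ 2 ^ (Fintype.card ι) := by
    intro Q
    have := Finset.card_filter_le (Finset.univ : Finset (ι → Bool)) Q
    simp only [Finset.card_univ, Fintype.card_fun, Fintype.card_bool] at this
    exact_mod_cast this
  have hbig : ∀ (s : ℝ) (n : ℕ), u ≤ s → 1 ≤ Real.exp (lam * (s - u)) * Real.cosh lam ^ n := by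
    intro s n h
    have h1 : 1 ≤ Real.exp (lam * (s - u)) := Real.one_le_exp (mul_nonneg hl (by linarith))
    have h2 : 1 ≤ Real.cosh lam ^ n := one_le_pow₀ (Real.one_le_cosh _)
    nlinarith
  induction A using Finset.induction_on_min_value x with
  | empty =>
    intro s
    by_cases hs : u ≤ s
    · have := hbig s 0 hs
      exact (htriv _).trans (le_mul_of_one_le_right (by positivity) (by simpa using this))
    · simp only [Finset.sum_empty, add_zero, hs, exists_const, Finset.filter_false,
        Finset.card_empty, Nat.cast_zero]
      positivity
  | insert i0 A hi0 hmin ih =>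
    intro s
    by_cases hs : u ≤ s
    · have := hbig s (insert i0 A).card hs
      exact (htriv _).trans (le_mul_of_one_le_right (by positivity) this)
    let Q : ℝ → (ι → Bool) → Prop := fun s σ =>
      ∃ t, u ≤ s + ∑ i ∈ A, e * sg (σ i) * ind t (x i)
    have hQ : ∀ s σ c, Q s (Function.update σ i0 c) ↔ Q s σ := by
      intro s σ c
      have : ∀ t, ∑ i ∈ A, e * sg (Function.update σ i0 c i) * ind t (x i) =
          ∑ i ∈ A, e * sg (σ i) * ind t (x i) := by
        intro t
        refine Finset.sum_congr rfl fun i hi => ?_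
        rw [Function.update_of_ne]
        rintro rfl; exact hi0 hi
      simp only [Q, this]
    have hsub : (Finset.univ.filter (fun σ : ι → Bool =>
        ∃ t, u ≤ s + ∑ i ∈ insert i0 A, e * sg (σ i) * ind t (x i))) ⊆
        (Finset.univ.filter (fun σ : ι → Bool => σ i0 = true ∧ Q (s + e) σ)) ∪
        (Finset.univ.filter (fun σ : ι → Bool => σ i0 = false ∧ Q (s - e) σ)) := by
      intro σ
      simp only [Finset.mem_filter, Finset.mem_univ, true_and, Finset.mem_union]
      rintro ⟨t, ht⟩
      by_cases hx : x i0 ≤ t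
      · rw [Finset.sum_insert hi0] at ht
        cases h : σ i0
        · right
          refine ⟨rfl, t, ?_⟩
          simp only [h, sg, ind, hx] at ht ⊢
          simp at ht ⊢; linarith
        · left
          refine ⟨rfl, t, ?_⟩
          simp only [h, sg, ind, hx] at ht ⊢
          simp at ht ⊢; linarith
      · exfalso
        rw [Finset.sum_eq_zero] at ht
        · exact hs (by linarith)
        · intro i hi
          have : ¬ x i ≤ t := by
            rcases Finset.mem_insert.1 hi with rfl | h
            · exact hx
            · have := hmin i h; intro h'; exact hx (this.trans h')
          simp [ind, this]
    have hc := (Finset.card_le_card hsub).trans (Finset.card_union_le _ _)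
    have hc' : ((Finset.univ.filter (fun σ : ι → Bool =>
        ∃ t, u ≤ s + ∑ i ∈ insert i0 A, e * sg (σ i) * ind t (x i))).card : ℝ) ≤
        ((Finset.univ.filter (fun σ : ι → Bool => σ i0 = true ∧ Q (s + e) σ)).card : ℝ) +
        ((Finset.univ.filter (fun σ : ι → Bool => σ i0 = false ∧ Q (s - e) σ)).card : ℝ) := by
      exact_mod_cast hc
    have e1 := card_half i0 true (Q (s + e)) (hQ _)
    have e2 := card_half i0 false (Q (s - e)) (hQ _)
    have i1 := ih (s + e)
    have i2 := ih (s - e)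
    rw [Finset.card_insert_of_notMem hi0]
    have hE : Real.exp (lam * (s + e - u)) + Real.exp (lam * (s - e - u)) =
        2 * (Real.exp (lam * (s - u)) * Real.cosh lam) := by
      rw [Real.cosh_eq]
      have a1 : lam * (s + e - u) = lam * (s - u) + lam * e := by ring
      have a2 : lam * (s - e - u) = lam * (s - u) + -(lam * e) := by ring
      rw [a1, a2, Real.exp_add, Real.exp_add]
      rcases he with rfl | rfl <;> simp <;> ring
    have hfin : 2 ^ (Fintype.card ι) * (Real.exp (lam * (s - u)) * Real.cosh lam ^ (A.card + 1)) =
      (2 ^ (Fintype.card ι) * (Real.exp (lam * (s + e - u)) * Real.cosh lam ^ A.card) +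
      2 ^ (Fintype.card ι) * (Real.exp (lam * (s - e - u)) * Real.cosh lam ^ A.card)) / 2 := by
      have : Real.exp (lam * (s + e - u)) =
        2 * (Real.exp (lam * (s - u)) * Real.cosh lam) - Real.exp (lam * (s - e - u)) := by
        linarith
      rw [this]; ring
    rw [hfin]
    simp only [Q] at e1 e2 hc'
    linarith

open Classical in
lemma sign_max_abs {k : ℕ} (x : Fin k → ℝ) (lam v : ℝ) (hl : 0 ≤ lam) :
    ((Finset.univ.filter (fun σ : Fin k → Bool =>
      ∃ t, v < |∑ i, sg (σ i) * ind t (x i)|)).card : ℝ) ≤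
      2 * (2 ^ k * Real.exp (k * lam ^ 2 / 2 - lam * v)) := by
  have key : ∀ e : ℝ, e = 1 ∨ e = -1 → ((Finset.univ.filter (fun σ : Fin k → Bool =>
      ∃ t, v ≤ 0 + ∑ i, e * sg (σ i) * ind t (x i))).card : ℝ) ≤
      2 ^ k * Real.exp (k * lam ^ 2 / 2 - lam * v) := by
    intro e he
    refine (sign_max x lam v e hl he Finset.univ 0).trans ?_
    simp only [Fintype.card_fin, Finset.card_univ]
    gcongr
    calc Real.exp (lam * (0 - v)) * Real.cosh lam ^ k
        ≤ Real.exp (lam * (0 - v)) * Real.exp (lam ^ 2 / 2) ^ k := by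
          gcongr
          exact Real.cosh_le_exp_half_sq _
      _ = _ := by
          rw [← Real.exp_nat_mul, ← Real.exp_add]; congr 1; ring
  have hsub : (Finset.univ.filter (fun σ : Fin k → Bool =>
      ∃ t, v < |∑ i, sg (σ i) * ind t (x i)|)) ⊆
      (Finset.univ.filter (fun σ : Fin k → Bool =>
      ∃ t, v ≤ 0 + ∑ i, (1:ℝ) * sg (σ i) * ind t (x i))) ∪
      (Finset.univ.filter (fun σ : Fin k → Bool =>
      ∃ t, v ≤ 0 + ∑ i, (-1:ℝ) * sg (σ i) * ind t (x i))) := by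
    intro σ
    simp only [Finset.mem_filter, Finset.mem_univ, true_and, Finset.mem_union]
    rintro ⟨t, ht⟩
    rcases lt_abs.1 ht with h | h
    · left; exact ⟨t, by simpa using h.le⟩
    · right; exact ⟨t, by simpa using h.le⟩
  have hc := (Finset.card_le_card hsub).trans (Finset.card_union_le _ _)
  have hc' := (Nat.cast_le (α := ℝ)).2 hc
  push_cast at hc'
  have := key 1 (Or.inl rfl)
  have := key (-1) (Or.inr rfl)
  linarith

open Classical in
lemma sign_max_pair {k : ℕ} (z : Fin k → ℝ × ℝ) (lam v : ℝ) (hl : 0 ≤ lam) :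
    ((Finset.univ.filter (fun σ : Fin k → Bool =>
      ∃ t, 2 * v < |∑ i, sg (σ i) * (ind t (z i).1 - ind t (z i).2)|)).card : ℝ) ≤
      4 * (2 ^ k * Real.exp (k * lam ^ 2 / 2 - lam * v)) := by
  have hsub : (Finset.univ.filter (fun σ : Fin k → Bool =>
      ∃ t, 2 * v < |∑ i, sg (σ i) * (ind t (z i).1 - ind t (z i).2)|)) ⊆
      (Finset.univ.filter (fun σ : Fin k → Bool =>
      ∃ t, v < |∑ i, sg (σ i) * ind t (z i).1|)) ∪
      (Finset.univ.filter (fun σ : Fin k → Bool =>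
      ∃ t, v < |∑ i, sg (σ i) * ind t (z i).2|)) := by
    intro σ
    simp only [Finset.mem_filter, Finset.mem_univ, true_and, Finset.mem_union]
    rintro ⟨t, ht⟩
    by_contra hcon
    push Not at hcon
    have h1 := hcon.1 t
    have h2 := hcon.2 t
    simp only [mul_sub, Finset.sum_sub_distrib] at ht
    have := abs_sub (∑ i, sg (σ i) * ind t (z i).1) (∑ i, sg (σ i) * ind t (z i).2)
    linarith
  have hc := (Finset.card_le_card hsub).trans (Finset.card_union_le _ _)
  have hc' := (Nat.cast_le (α := ℝ)).2 hc
  push_cast at hc'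
  have := sign_max_abs (fun i => (z i).1) lam v hl
  have := sign_max_abs (fun i => (z i).2) lam v hl
  linarith

lemma measurable_ind (t : ℝ) : Measurable (ind t) := by
  unfold ind
  exact Measurable.ite measurableSet_Iic measurable_const measurable_const

lemma ind_mem (t x : ℝ) : ind t x ∈ Set.Icc (0 : ℝ) 1 := by
  unfold ind; split_ifs <;> simp

lemma integral_ind (μ : Measure ℝ) (t : ℝ) : ∫ x, ind t x ∂μ = μ.real (Set.Iic t) := by
  have : ind t = Set.indicator (Set.Iic t) (fun _ => (1 : ℝ)) := by
    ext x; simp [ind, Set.indicator]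
  rw [this, integral_indicator_const _ measurableSet_Iic]; simp

lemma pair_bound (μ : Measure ℝ) [IsProbabilityMeasure μ] (T : Finset ℝ) (k : ℕ) (lam v : ℝ)
    (hl : 0 ≤ lam) :
    (Measure.pi (fun _ : Fin k => μ.prod μ))
      {z | ∃ t ∈ T, 2 * v < |∑ i, (ind t (z i).1 - ind t (z i).2)|} ≤
      ENNReal.ofReal (4 * Real.exp (k * lam ^ 2 / 2 - lam * v)) := by
  classical
  set P := Measure.pi (fun _ : Fin k => μ.prod μ) with hP
  set A : Set (Fin k → ℝ × ℝ) :=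
    {z | ∃ t ∈ T, 2 * v < |∑ i, (ind t (z i).1 - ind t (z i).2)|} with hA
  have hAm : MeasurableSet A := by
    have : A = ⋃ t ∈ T, {z | 2 * v < |∑ i, (ind t (z i).1 - ind t (z i).2)|} := by
      ext z; simp [hA]
    rw [this]
    refine Finset.measurableSet_biUnion _ fun t _ => ?_
    refine measurableSet_lt measurable_const ?_
    have hm := measurable_ind t
    have : Measurable fun z : Fin k → ℝ × ℝ => ∑ i, (ind t (z i).1 - ind t (z i).2) := by
      refine Finset.measurable_sum _ fun i _ => ?_
      exact (hm.comp (by fun_prop)).sub (hm.comp (by fun_prop))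
    exact this.abs
  let sw : (Fin k → Bool) → (Fin k → ℝ × ℝ) → (Fin k → ℝ × ℝ) :=
    fun σ z i => (if σ i then id else Prod.swap) (z i)
  have hsw : ∀ σ, MeasurePreserving (sw σ) P P := by
    intro σ
    refine measurePreserving_pi (fun _ : Fin k => μ.prod μ) (fun _ : Fin k => μ.prod μ)
      (f := fun i => if σ i then id else Prod.swap) fun i => ?_
    cases σ i
    · simpa using Measure.measurePreserving_swap
    · simpa using MeasurePreserving.id _
  have hmem : ∀ σ z, z ∈ sw σ ⁻¹' A ↔
      ∃ t ∈ T, 2 * v < |∑ i, sg (σ i) * (ind t (z i).1 - ind t (z i).2)| := by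
    intro σ z
    have : ∀ t, ∑ i, (ind t (sw σ z i).1 - ind t (sw σ z i).2) =
        ∑ i, sg (σ i) * (ind t (z i).1 - ind t (z i).2) := by
      intro t
      refine Finset.sum_congr rfl fun i _ => ?_
      cases h : σ i <;> simp [sw, h, sg]
    simp only [Set.mem_preimage, hA, Set.mem_ofPred_eq, this]
  have h1 : (2 : ℝ≥0∞) ^ k * P A = ∑ σ : Fin k → Bool, P (sw σ ⁻¹' A) := by
    rw [Finset.sum_congr rfl fun σ _ => (hsw σ).measure_preimage hAm.nullMeasurableSet]
    simp
  have h2 : ∑ σ : Fin k → Bool, P (sw σ ⁻¹' A) =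
      ∫⁻ z, ∑ σ : Fin k → Bool, (sw σ ⁻¹' A).indicator 1 z ∂P := by
    rw [lintegral_finsetSum]
    · refine Finset.sum_congr rfl fun σ _ => ?_
      rw [lintegral_indicator_one ((hsw σ).measurable hAm)]
    · intro σ _
      exact measurable_one.indicator ((hsw σ).measurable hAm)
  have h3 : ∀ z, ∑ σ : Fin k → Bool, (sw σ ⁻¹' A).indicator (1 : (Fin k → ℝ × ℝ) → ℝ≥0∞) z ≤
      2 ^ k * ENNReal.ofReal (4 * Real.exp (k * lam ^ 2 / 2 - lam * v)) := by
    intro z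
    have e1 : ∑ σ : Fin k → Bool, (sw σ ⁻¹' A).indicator (1 : (Fin k → ℝ × ℝ) → ℝ≥0∞) z =
        ((Finset.univ.filter (fun σ : Fin k → Bool => z ∈ sw σ ⁻¹' A)).card : ℝ≥0∞) := by
      simp only [Set.indicator, Pi.one_apply]
      rw [Finset.sum_boole]
    rw [e1]
    have e2 : ((Finset.univ.filter (fun σ : Fin k → Bool => z ∈ sw σ ⁻¹' A)).card : ℝ) ≤
        4 * (2 ^ k * Real.exp (k * lam ^ 2 / 2 - lam * v)) := by
      refine le_trans ?_ (sign_max_pair z lam v hl)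
      norm_cast
      refine Finset.card_le_card fun σ h => ?_
      simp only [Finset.mem_filter, Finset.mem_univ, true_and] at h ⊢
      obtain ⟨t, _, ht⟩ := (hmem σ z).1 h
      exact ⟨t, ht⟩
    have e3 : (2 : ℝ≥0∞) ^ k = ENNReal.ofReal (2 ^ k) := by
      rw [ENNReal.ofReal_pow (by norm_num)]; simp
    rw [e3, ← ENNReal.ofReal_mul (by positivity), ← ENNReal.ofReal_natCast]
    exact ENNReal.ofReal_le_ofReal (e2.trans (le_of_eq (by ring)))
  have h4 : (2 : ℝ≥0∞) ^ k * P A ≤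
      2 ^ k * ENNReal.ofReal (4 * Real.exp (k * lam ^ 2 / 2 - lam * v)) := by
    rw [h1, h2]
    refine (lintegral_mono h3).trans ?_
    simp
  exact (ENNReal.mul_le_mul_iff_right (by simp) (by simp)).1 h4

lemma cheb (μ : Measure ℝ) [IsProbabilityMeasure μ] (k : ℕ) (hk : 0 < k) (η : ℝ) (hη : 0 < η)
    (h2 : 2 ≤ k * η ^ 2) (t : ℝ) :
    (Measure.pi (fun _ : Fin k => μ))
      {y | k * η / 2 ≤ |∑ i, ind t (y i) - k * μ.real (Set.Iic t)|} ≤ ENNReal.ofReal (1 / 2) := by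
  have hk' : (0 : ℝ) < k := by exact_mod_cast hk
  have hL : MemLp (ind t) 2 μ :=
    memLp_of_bounded (Filter.Eventually.of_forall (ind_mem t))
      (measurable_ind t).aestronglyMeasurable 2
  have hLi : ∀ i : Fin k, MemLp (fun y : Fin k → ℝ => ind t (y i)) 2
      (Measure.pi (fun _ : Fin k => μ)) := fun i =>
    hL.comp_measurePreserving (measurePreserving_eval (fun _ : Fin k => μ) i)
  have hv := ProbabilityTheory.variance_sum_pi (ι := Fin k) (μ := fun _ => μ)
    (X := fun _ => ind t) (fun _ => hL)
  have hv1 : ProbabilityTheory.variance (ind t) μ ≤ ((1 - 0) / 2) ^ 2 :=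
    ProbabilityTheory.variance_le_sq_of_bounded (Filter.Eventually.of_forall (ind_mem t))
      (measurable_ind t).aemeasurable
  have hX : MemLp (∑ i : Fin k, fun y : Fin k → ℝ => ind t (y i)) 2
      (Measure.pi (fun _ : Fin k => μ)) := memLp_finsetSum' _ fun i _ => hLi i
  have hc := ProbabilityTheory.meas_ge_le_variance_div_sq hX (c := k * η / 2) (by positivity)
  have hE : ∫ y, (∑ i : Fin k, fun y : Fin k → ℝ => ind t (y i)) y
      ∂(Measure.pi (fun _ : Fin k => μ)) = k * μ.real (Set.Iic t) := by
    simp only [Finset.sum_apply]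
    rw [integral_finsetSum _ fun i _ => (hLi i).integrable (by norm_num)]
    have : ∀ i : Fin k, ∫ y : Fin k → ℝ, ind t (y i) ∂(Measure.pi (fun _ : Fin k => μ)) =
        μ.real (Set.Iic t) := by
      intro i
      rw [← integral_ind]
      have hm := measurePreserving_eval (fun _ : Fin k => μ) i
      have := integral_map (μ := Measure.pi (fun _ : Fin k => μ)) hm.measurable.aemeasurable
        (f := ind t) (measurable_ind t).aestronglyMeasurable
      rw [hm.map_eq] at this
      exact this.symm
    simp [this]
  rw [hE, hv] at hc
  simp only [Finset.sum_apply] at hc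
  refine hc.trans (ENNReal.ofReal_le_ofReal ?_)
  simp only [Finset.sum_const, Finset.card_univ, Fintype.card_fin, nsmul_eq_mul]
  rw [div_le_iff₀ (by positivity)]
  nlinarith

lemma symm_bound (μ : Measure ℝ) [IsProbabilityMeasure μ] (k : ℕ) (hk : 0 < k) (η : ℝ)
    (hη : 0 < η) (h2 : 2 ≤ k * η ^ 2) (T : Finset ℝ) :
    (Measure.pi (fun _ : Fin k => μ))
      {x | ∃ t ∈ T, k * η < |∑ i, ind t (x i) - k * μ.real (Set.Iic t)|} ≤
      ENNReal.ofReal (8 * Real.exp (- (k * η ^ 2 / 32))) := by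
  have hk' : (0 : ℝ) < k := by exact_mod_cast hk
  set P := Measure.pi (fun _ : Fin k => μ) with hP
  set B : Set (Fin k → ℝ) := {x | ∃ t ∈ T, k * η < |∑ i, ind t (x i) - k * μ.real (Set.Iic t)|}
    with hB
  have hms : ∀ t, Measurable fun x : Fin k → ℝ => ∑ i, ind t (x i) := fun t =>
    Finset.measurable_sum _ fun i _ => (measurable_ind t).comp (measurable_pi_apply i)
  have hBm : MeasurableSet B := by
    have : B = ⋃ t ∈ T, {x | k * η < |∑ i, ind t (x i) - k * μ.real (Set.Iic t)|} := by
      ext z; simp [hB]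
    rw [this]
    refine Finset.measurableSet_biUnion _ fun t _ => ?_
    exact measurableSet_lt measurable_const ((hms t).sub measurable_const).abs
  set C : Set ((Fin k → ℝ) × (Fin k → ℝ)) :=
    {p | ∃ t ∈ T, k * η / 2 < |∑ i, (ind t (p.1 i) - ind t (p.2 i))|} with hC
  have hCm : MeasurableSet C := by
    have : C = ⋃ t ∈ T, {p : (Fin k → ℝ) × (Fin k → ℝ) |
        k * η / 2 < |∑ i, (ind t (p.1 i) - ind t (p.2 i))|} := by
      ext z; simp [hC]
    rw [this]
    refine Finset.measurableSet_biUnion _ fun t _ => ?_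
    simp only [Finset.sum_sub_distrib]
    exact measurableSet_lt measurable_const
      (((hms t).comp measurable_fst).sub ((hms t).comp measurable_snd)).abs
  have hsec : ∀ x ∈ B, ENNReal.ofReal (1 / 2) ≤ P (Prod.mk x ⁻¹' C) := by
    rintro x ⟨t, htT, ht⟩
    have hch := cheb μ k hk η hη h2 t
    set N : Set (Fin k → ℝ) := {y | k * η / 2 ≤ |∑ i, ind t (y i) - k * μ.real (Set.Iic t)|}
      with hN
    have hNm : MeasurableSet N :=
      measurableSet_le measurable_const ((hms t).sub measurable_const).abs
    have hsub : Nᶜ ⊆ Prod.mk x ⁻¹' C := by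
      intro y hy
      simp only [hN, Set.mem_compl_iff, Set.mem_ofPred_eq, not_le] at hy
      refine ⟨t, htT, ?_⟩
      simp only [Finset.sum_sub_distrib]
      have := abs_sub_abs_le_abs_sub (∑ i, ind t (x i) - k * μ.real (Set.Iic t))
        (∑ i, ind t (y i) - k * μ.real (Set.Iic t))
      rw [sub_sub_sub_cancel_right] at this
      linarith
    refine le_trans ?_ (measure_mono hsub)
    rw [prob_compl_eq_one_sub hNm]
    refine ENNReal.le_sub_of_add_le_right (by finiteness) ?_
    calc ENNReal.ofReal (1 / 2) + P N ≤ ENNReal.ofReal (1 / 2) + ENNReal.ofReal (1 / 2) := by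
          gcongr
      _ = 1 := by rw [← ENNReal.ofReal_add (by norm_num) (by norm_num)]; norm_num
  have hfub : ENNReal.ofReal (1 / 2) * P B ≤ (P.prod P) C := by
    rw [Measure.prod_apply hCm]
    calc ENNReal.ofReal (1 / 2) * P B = ∫⁻ x in B, ENNReal.ofReal (1 / 2) ∂P := by simp
      _ ≤ ∫⁻ x in B, P (Prod.mk x ⁻¹' C) ∂P := setLIntegral_mono' hBm hsec
      _ ≤ _ := setLIntegral_le_lintegral _ _
  have hmp := measurePreserving_arrowProdEquivProdArrow ℝ ℝ (Fin k) (fun _ => μ) (fun _ => μ)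
  have hpb := pair_bound μ T k (η / 4) (k * η / 4) (by positivity)
  have hCb : (P.prod P) C ≤ ENNReal.ofReal (4 * Real.exp (- (k * η ^ 2 / 32))) := by
    rw [hP, ← hmp.measure_preimage hCm.nullMeasurableSet]
    have e1 : (MeasurableEquiv.arrowProdEquivProdArrow ℝ ℝ (Fin k)) ⁻¹' C =
      {z | ∃ t ∈ T, 2 * (k * η / 4) < |∑ i, (ind t (z i).1 - ind t (z i).2)|} := by
      ext z
      have : 2 * (k * η / 4) = k * η / 2 := by ring
      rw [this]
      rfl
    rw [e1]
    refine hpb.trans (ENNReal.ofReal_le_ofReal (le_of_eq ?_))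
    congr 2; ring
  have h8 : P B = ENNReal.ofReal 2 * (ENNReal.ofReal (1 / 2) * P B) := by
    rw [← mul_assoc, ← ENNReal.ofReal_mul (by norm_num)]; norm_num
  rw [h8]
  calc ENNReal.ofReal 2 * (ENNReal.ofReal (1 / 2) * P B)
      ≤ ENNReal.ofReal 2 * ENNReal.ofReal (4 * Real.exp (- (k * η ^ 2 / 32))) := by
        gcongr; exact hfub.trans hCb
    _ = _ := by rw [← ENNReal.ofReal_mul (by norm_num)]; congr 1; ring

/-- discrepancy bound passes to monotone limits -/
lemma disc_lim (μ ν : Measure ℝ) [IsFiniteMeasure μ] [IsFiniteMeasure ν] (η : ℝ)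
    (S : ℕ → Set ℝ) (L : Set ℝ)
    (h1 : Filter.Tendsto (fun n => μ (S n)) Filter.atTop (nhds (μ L)))
    (h2 : Filter.Tendsto (fun n => ν (S n)) Filter.atTop (nhds (ν L)))
    (h : ∀ n, |ν.real (S n) - μ.real (S n)| ≤ η) : |ν.real L - μ.real L| ≤ η := by
  have h1' := (ENNReal.tendsto_toReal (measure_ne_top μ L)).comp h1
  have h2' := (ENNReal.tendsto_toReal (measure_ne_top ν L)).comp h2
  exact le_of_tendsto (h2'.sub h1').abs (Filter.Eventually.of_forall h)

lemma disc_Iic (μ ν : Measure ℝ) [IsProbabilityMeasure μ] [IsProbabilityMeasure ν] (η : ℝ)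
    (h : ∀ q : ℚ, |ν.real (Set.Iic (q : ℝ)) - μ.real (Set.Iic (q : ℝ))| ≤ η) (t : ℝ) :
    |ν.real (Set.Iic t) - μ.real (Set.Iic t)| ≤ η := by
  obtain ⟨u, hu, hut, hul⟩ := (Rat.isDenseEmbedding_coe_real.dense).exists_seq_strictAnti_tendsto
    Rat.cast_mono t
  have hI : Set.Iic t = ⋂ n, Set.Iic ((u n : ℝ)) := by
    ext x
    simp only [Set.mem_Iic, Set.mem_iInter]
    exact ⟨fun hx n => hx.trans (le_of_lt (hut n)), fun hx => ge_of_tendsto' hul hx⟩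
  have ha : Antitone fun n => Set.Iic ((u n : ℝ)) := fun a b hab =>
    Set.Iic_subset_Iic.2 (Rat.cast_le.2 (hu.antitone hab))
  refine disc_lim μ ν η (fun n => Set.Iic ((u n : ℝ))) _ ?_ ?_ ?_
  · rw [hI]
    exact tendsto_measure_iInter_atTop (fun n => measurableSet_Iic.nullMeasurableSet) ha
      ⟨0, measure_ne_top _ _⟩
  · rw [hI]
    exact tendsto_measure_iInter_atTop (fun n => measurableSet_Iic.nullMeasurableSet) ha
      ⟨0, measure_ne_top _ _⟩
  · intro n
    exact h (u n)

lemma lower_cases (L : Set ℝ) (hL : IsLowerSet L) :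
    L = ∅ ∨ L = Set.univ ∨ (∃ t, L = Set.Iic t) ∨ ∃ t, L = Set.Iio t := by
  rcases L.eq_empty_or_nonempty with h | hne
  · exact Or.inl h
  right
  by_cases hb : BddAbove L
  · right
    by_cases hs : sSup L ∈ L
    · left
      refine ⟨sSup L, Set.Subset.antisymm (fun x hx => le_csSup hb hx) fun x hx => hL hx hs⟩
    · right
      refine ⟨sSup L, Set.Subset.antisymm (fun x hx => ?_) fun x hx => ?_⟩
      · refine lt_of_le_of_ne (le_csSup hb hx) ?_
        rintro rfl; exact hs hx
      · obtain ⟨y, hy, hxy⟩ := exists_lt_of_lt_csSup hne hx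
        exact hL hxy.le hy
  · left
    refine Set.eq_univ_of_forall fun x => ?_
    rw [not_bddAbove_iff] at hb
    obtain ⟨y, hy, hxy⟩ := hb x
    exact hL hxy.le hy

lemma lower_measurable (L : Set ℝ) (hL : IsLowerSet L) : MeasurableSet L := by
  rcases lower_cases L hL with rfl | rfl | ⟨t, rfl⟩ | ⟨t, rfl⟩ <;> measurability

lemma disc_lower (μ ν : Measure ℝ) [IsProbabilityMeasure μ] [IsProbabilityMeasure ν] (η : ℝ)
    (hη : 0 ≤ η)
    (h : ∀ q : ℚ, |ν.real (Set.Iic (q : ℝ)) - μ.real (Set.Iic (q : ℝ))| ≤ η)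
    (L : Set ℝ) (hL : IsLowerSet L) : |ν.real L - μ.real L| ≤ η := by
  rcases lower_cases L hL with rfl | rfl | ⟨t, rfl⟩ | ⟨t, rfl⟩
  · simpa using hη
  · simpa using hη
  · exact disc_Iic μ ν η h t
  · obtain ⟨u, hu, hut, hul⟩ := exists_seq_strictMono_tendsto t
    have hI : Set.Iio t = ⋃ n, Set.Iic (u n) := by
      ext x
      simp only [Set.mem_Iio, Set.mem_iUnion, Set.mem_Iic]
      constructor
      · intro hx
        obtain ⟨n, hn⟩ := (hul.eventually (lt_mem_nhds hx)).exists
        exact ⟨n, hn.le⟩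
      · rintro ⟨n, hn⟩; exact hn.trans_lt (hut n)
    have ha : Monotone fun n => Set.Iic (u n) := fun a b hab =>
      Set.Iic_subset_Iic.2 (hu.monotone hab)
    refine disc_lim μ ν η (fun n => Set.Iic (u n)) _ ?_ ?_ fun n => disc_Iic μ ν η h _
    · rw [hI]; exact tendsto_measure_iUnion_atTop ha
    · rw [hI]; exact tendsto_measure_iUnion_atTop ha

lemma disc_ordConnected (μ ν : Measure ℝ) [IsProbabilityMeasure μ] [IsProbabilityMeasure ν] (η : ℝ)
    (hη : 0 ≤ η)
    (h : ∀ q : ℚ, |ν.real (Set.Iic (q : ℝ)) - μ.real (Set.Iic (q : ℝ))| ≤ η)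
    (I : Set ℝ) (hI : I.OrdConnected) : |ν.real I - μ.real I| ≤ 2 * η := by
  set L : Set ℝ := {x | ∃ y ∈ I, x ≤ y} with hLdef
  set K : Set ℝ := {x | (∃ y ∈ I, x ≤ y) ∧ ∀ y ∈ I, x < y} with hKdef
  have hL : IsLowerSet L := by
    rintro a b hab ⟨y, hy, hy'⟩
    exact ⟨y, hy, hab.trans hy'⟩
  have hK : IsLowerSet K := by
    rintro a b hab ⟨⟨y, hy, hy'⟩, h2⟩
    exact ⟨⟨y, hy, hab.trans hy'⟩, fun z hz => hab.trans_lt (h2 z hz)⟩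
  have hKL : K ⊆ L := fun x hx => hx.1
  have hIeq : I = L \ K := by
    ext x
    constructor
    · intro hx
      exact ⟨⟨x, hx, le_rfl⟩, fun hk => lt_irrefl _ (hk.2 x hx)⟩
    · rintro ⟨⟨y, hy, hxy⟩, hk⟩
      have : ∃ z ∈ I, z ≤ x := by
        by_contra hcon
        push Not at hcon
        exact hk ⟨⟨y, hy, hxy⟩, hcon⟩
      obtain ⟨z, hz, hzx⟩ := this
      exact hI.out hz hy ⟨hzx, hxy⟩
  rw [hIeq, measureReal_sdiff hKL (lower_measurable K hK), measureReal_sdiff hKL (lower_measurable K hK)]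
  have a := abs_le.1 (disc_lower μ ν η hη h L hL)
  have b := abs_le.1 (disc_lower μ ν η hη h K hK)
  exact abs_le.2 ⟨by linarith, by linarith⟩

lemma emp_prob (k : ℕ) (hk : 0 < k) (x : Fin k → ℝ) :
    IsProbabilityMeasure (empiricalMeasure k x) := by
  constructor
  rw [empiricalMeasure, Measure.smul_apply, Measure.finsetSum_apply]
  simp only [measure_univ, Finset.sum_const, Finset.card_univ, Fintype.card_fin,
    nsmul_eq_mul, mul_one, smul_eq_mul]
  exact ENNReal.inv_mul_cancel (by exact_mod_cast hk.ne') (by simp)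

lemma emp_Iic (k : ℕ) (x : Fin k → ℝ) (t : ℝ) :
    (empiricalMeasure k x).real (Set.Iic t) = (∑ i, ind t (x i)) / k := by
  rw [measureReal_def, empiricalMeasure, Measure.smul_apply, Measure.finsetSum_apply]
  rw [smul_eq_mul, ENNReal.toReal_mul, ENNReal.toReal_sum (by intros; finiteness)]
  simp only [measurableSet_Iic, Measure.dirac_apply', ENNReal.toReal_inv, ENNReal.toReal_natCast]
  rw [div_eq_inv_mul]
  congr 1
  refine Finset.sum_congr rfl fun i _ => ?_
  by_cases h : x i ≤ t <;> simp [ind, Set.indicator, h]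

lemma dkw (μ : Measure ℝ) [IsProbabilityMeasure μ] (k : ℕ) (hk : 0 < k) (η : ℝ)
    (hη : 0 < η) (h2 : 2 ≤ k * η ^ 2) :
    ∃ G : Set (Fin k → ℝ), MeasurableSet G ∧
      (Measure.pi (fun _ : Fin k => μ)) Gᶜ ≤ ENNReal.ofReal (8 * Real.exp (- (k * η ^ 2 / 32))) ∧
      ∀ x ∈ G, ∀ I : Set ℝ, I.OrdConnected →
        |(empiricalMeasure k x).real I - μ.real I| ≤ 2 * η := by
  have hk' : (0 : ℝ) < k := by exact_mod_cast hk
  have hms : ∀ t, Measurable fun x : Fin k → ℝ => ∑ i, ind t (x i) := fun t =>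
    Finset.measurable_sum _ fun i _ => (measurable_ind t).comp (measurable_pi_apply i)
  let G : Set (Fin k → ℝ) :=
    ⋂ q : ℚ, {x | |∑ i, ind (q : ℝ) (x i) - k * μ.real (Set.Iic (q : ℝ))| ≤ k * η}
  refine ⟨G, ?_, ?_, ?_⟩
  · exact MeasurableSet.iInter fun q =>
      measurableSet_le ((hms q).sub measurable_const).abs measurable_const
  · let B : Finset ℚ → Set (Fin k → ℝ) := fun T =>
      {x | ∃ t ∈ T.image (fun q : ℚ => (q : ℝ)), k * η < |∑ i, ind t (x i) - k * μ.real (Set.Iic t)|}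
    have hG : Gᶜ = ⋃ T, B T := by
      ext x
      simp only [G, B, Set.mem_compl_iff, Set.mem_iInter, Set.mem_ofPred_eq, not_forall, not_le,
        Set.mem_iUnion, Finset.exists_mem_image]
      constructor
      · rintro ⟨q, hq⟩; exact ⟨{q}, q, by simp, hq⟩
      · rintro ⟨T, q, _, hq⟩; exact ⟨q, hq⟩
    have hd : Directed (· ⊆ ·) B := by
      refine Monotone.directed_le (f := B) fun S T hST x hx => ?_
      obtain ⟨t, ht, h⟩ := hx
      exact ⟨t, Finset.image_subset_image hST ht, h⟩
    rw [hG, hd.measure_iUnion]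
    exact iSup_le fun T => symm_bound μ k hk η hη h2 _
  · intro x hx I hI
    have := emp_prob k hk x
    refine disc_ordConnected μ _ η hη.le (fun q => ?_) I hI
    have hq := Set.mem_iInter.1 hx q
    simp only [Set.mem_ofPred_eq] at hq
    rw [emp_Iic]
    have e : (∑ i, ind (q : ℝ) (x i)) / k - μ.real (Set.Iic (q : ℝ)) =
      (∑ i, ind (q : ℝ) (x i) - k * μ.real (Set.Iic (q : ℝ))) / k := by
      field_simp
    rw [e, abs_div, abs_of_pos hk', div_le_iff₀ hk']
    linarith

lemma prod_real (μ : Measure ℝ) {n : ℕ} (ν : Measure (Fin n → ℝ)) [IsProbabilityMeasure μ]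
    [IsProbabilityMeasure ν] (F : Set (ℝ × (Fin n → ℝ))) (hF : MeasurableSet F) :
    (μ.prod ν).real F = ∫ x, ν.real (Prod.mk x ⁻¹' F) ∂μ := by
  rw [measureReal_def, Measure.prod_apply hF,
    ← integral_toReal (measurable_measure_prodMk_left hF).aemeasurable
      (Filter.Eventually.of_forall fun x => measure_lt_top _ _)]
  rfl

lemma prod_real_symm (μ : Measure ℝ) {n : ℕ} (ν : Measure (Fin n → ℝ)) [IsProbabilityMeasure μ]
    [IsProbabilityMeasure ν] (F : Set (ℝ × (Fin n → ℝ))) (hF : MeasurableSet F) :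
    (μ.prod ν).real F = ∫ y, μ.real ((fun x => (x, y)) ⁻¹' F) ∂ν := by
  rw [measureReal_def, Measure.prod_apply_symm hF,
    ← integral_toReal (measurable_measure_prodMk_right hF).aemeasurable
      (Filter.Eventually.of_forall fun x => measure_lt_top _ _)]
  rfl

lemma int_real {α : Type*} [MeasurableSpace α] (μ : Measure α) [IsProbabilityMeasure μ]
    {β : Type*} [MeasurableSpace β] (ν : Measure β) [IsProbabilityMeasure ν] (S : α → Set β)
    (h : Measurable fun x => ν (S x)) : Integrable (fun x => ν.real (S x)) μ :=
  (memLp_of_bounded (a := 0) (b := 1)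
    (Filter.Eventually.of_forall fun x => ⟨measureReal_nonneg, measureReal_le_one⟩)
    h.ennreal_toReal.aestronglyMeasurable 1).integrable le_rfl

lemma abs_int_le {α : Type*} [MeasurableSpace α] (μ : Measure α) [IsProbabilityMeasure μ]
    (f g : α → ℝ) (hf : Integrable f μ) (hg : Integrable g μ) (c : ℝ)
    (h : ∀ x, |f x - g x| ≤ c) : |∫ x, f x ∂μ - ∫ x, g x ∂μ| ≤ c := by
  rw [← integral_sub hf hg]
  have := norm_integral_le_of_norm_le_const (μ := μ) (f := fun x => f x - g x) (C := c)
    (Filter.Eventually.of_forall h)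
  simpa using this

lemma hybrid (η : ℝ) : ∀ (n : ℕ) (μ ν : Fin n → Measure ℝ)
    (_ : ∀ i, IsProbabilityMeasure (μ i)) (_ : ∀ i, IsProbabilityMeasure (ν i))
    (_ : ∀ i (I : Set ℝ), I.OrdConnected → |(ν i).real I - (μ i).real I| ≤ η)
    (E : Set (Fin n → ℝ)), MeasurableSet E → SingleIntersecting E →
    |(Measure.pi ν).real E - (Measure.pi μ).real E| ≤ n * η := by
  intro n
  induction n with
  | zero =>
    intro μ ν _ _ _ E _ _
    have : μ = ν := Subsingleton.elim _ _
    subst this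
    simp
  | succ n ih =>
    intro μ ν hμ hν h E hE hS
    set F : Set (ℝ × (Fin n → ℝ)) :=
      (MeasurableEquiv.piFinSuccAbove (fun _ => ℝ) (0 : Fin (n + 1))).symm ⁻¹' E with hF
    have hFm : MeasurableSet F := (MeasurableEquiv.measurable _) hE
    have hmem : ∀ x y, (x, y) ∈ F ↔ (Fin.cons x y : Fin (n + 1) → ℝ) ∈ E := by
      intro x y
      simp [hF, MeasurableEquiv.piFinSuccAbove, Fin.insertNthEquiv]
    have hpi : ∀ (m : Fin (n + 1) → Measure ℝ) (_ : ∀ i, IsProbabilityMeasure (m i)),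
        (Measure.pi m).real E = ((m 0).prod (Measure.pi fun j : Fin n => m j.succ)).real F := by
      intro m _
      have := (measurePreserving_piFinSuccAbove m 0).measure_preimage hFm.nullMeasurableSet
      rw [measureReal_def, measureReal_def]
      congr 1
      simp only [Fin.zero_succAbove] at this
      rw [← this, hF, ← Set.preimage_comp]
      simp
    rw [hpi μ hμ, hpi ν hν]
    set μ' := Measure.pi fun j : Fin n => μ j.succ
    set ν' := Measure.pi fun j : Fin n => ν j.succ
    have h1 : |((ν 0).prod ν').real F - ((ν 0).prod μ').real F| ≤ n * η := by
      rw [prod_real _ _ _ hFm, prod_real _ _ _ hFm]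
      refine abs_int_le _ _ _ (int_real _ _ _ (measurable_measure_prodMk_left hFm))
        (int_real _ _ _ (measurable_measure_prodMk_left hFm)) _ fun x => ?_
      refine ih (fun j => μ j.succ) (fun j => ν j.succ) (fun j => hμ _) (fun j => hν _)
        (fun j I hI => h j.succ I hI) _ (measurable_prodMk_left hFm) ?_
      intro i a
      have := hS i.succ (Fin.cons x a)
      convert this using 1
      ext v
      simp only [Set.mem_ofPred_eq, Set.mem_preimage, hmem, Fin.cons_update]
    have h2 : |((ν 0).prod μ').real F - ((μ 0).prod μ').real F| ≤ η := by
      rw [prod_real_symm _ _ _ hFm, prod_real_symm _ _ _ hFm]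
      refine abs_int_le _ _ _ (int_real _ _ _ (measurable_measure_prodMk_right hFm))
        (int_real _ _ _ (measurable_measure_prodMk_right hFm)) _ fun y => ?_
      refine h 0 _ ?_
      have := hS 0 (Fin.cons 0 y)
      convert this using 1
      ext v
      simp only [Set.mem_ofPred_eq, Set.mem_preimage, hmem, Fin.update_cons_zero]
    have := abs_sub_le (((ν 0).prod ν').real F) (((ν 0).prod μ').real F) (((μ 0).prod μ').real F)
    push_cast
    linarith

end SIProof

/-- Uniform convergence for single-intersecting events under product
measures via per-coordinate empirical distributions: there is an absolute constant `c > 0`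
such that for all `ℓ ≥ 1`, `ε, δ ∈ (0,1)`, any `k ≥ c·(ℓ²/ε²)·log(2ℓ/δ)`, and any product of
probability measures `D₁ × ⋯ × D_ℓ` on `ℝ^ℓ`, with probability at least `1 - δ` over `k`
i.i.d. samples, the product of the per-coordinate empirical distributions approximates the
product measure to within `ε` on every Borel single-intersecting set simultaneously. -/
theorem empirical_uniform_convergence_singleIntersecting :
    ∃ c : ℝ, 0 < c ∧
      ∀ (ℓ : ℕ), 1 ≤ ℓ → ∀ ε δ : ℝ, ε ∈ Set.Ioo (0 : ℝ) 1 → δ ∈ Set.Ioo (0 : ℝ) 1 →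
      ∀ k : ℕ, c * ((ℓ : ℝ) ^ 2 / ε ^ 2) * Real.log (2 * ℓ / δ) ≤ k →
      ∀ D : Fin ℓ → Measure ℝ, (∀ i, IsProbabilityMeasure (D i)) →
      ∃ G : Set (Fin k → (Fin ℓ → ℝ)), MeasurableSet G ∧
        ENNReal.ofReal (1 - δ) ≤ Measure.pi (fun _ : Fin k => Measure.pi D) G ∧
        ∀ x ∈ G, ∀ E : Set (Fin ℓ → ℝ), MeasurableSet E → SingleIntersecting E →
          |((Measure.pi (fun i => empiricalMeasure k (fun t => x t i))) E).toReal -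
            ((Measure.pi D) E).toReal| ≤ ε := by
  refine ⟨512, by norm_num, ?_⟩
  intro ℓ hℓ ε δ hε hδ k hk D hD
  have hl1 : (1 : ℝ) ≤ ℓ := by exact_mod_cast hℓ
  have hε0 := hε.1
  have hδ0 := hδ.1
  have hδ1 := hδ.2
  set R := Real.log (2 * ℓ / δ) with hR
  have hq : 2 ≤ 2 * ℓ / δ := by
    rw [le_div_iff₀ hδ0]; nlinarith
  have hR2 : Real.log 2 ≤ R := Real.log_le_log (by norm_num) hq
  have hlog2 := Real.log_two_gt_d9
  have hRpos : 0 < R := by linarith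
  have hkpos : (0 : ℝ) < k := lt_of_lt_of_le (by positivity) hk
  have hk0 : 0 < k := by exact_mod_cast hkpos
  set η := ε / (2 * ℓ) with hη
  have hη0 : 0 < η := by positivity
  have hkη : 128 * R ≤ k * η ^ 2 := by
    have e : 128 * R = (512 * ((ℓ : ℝ) ^ 2 / ε ^ 2) * R) * η ^ 2 := by
      rw [hη]; field_simp; norm_num
    rw [e]
    exact mul_le_mul_of_nonneg_right hk (by positivity)
  have h2 : 2 ≤ k * η ^ 2 := by linarith
  choose G hGm hGp hGe using fun i => SIProof.dkw (D i) k hk0 η hη0 h2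
  let pr : Fin ℓ → (Fin k → (Fin ℓ → ℝ)) → (Fin k → ℝ) := fun i x t => x t i
  have hpr : ∀ i, MeasurePreserving (pr i) (Measure.pi (fun _ : Fin k => Measure.pi D))
      (Measure.pi (fun _ : Fin k => D i)) := fun i =>
    measurePreserving_pi (fun _ : Fin k => Measure.pi D) (fun _ : Fin k => D i)
      (f := fun _ y => y i) fun _ => measurePreserving_eval D i
  have hbm : MeasurableSet (⋂ i, pr i ⁻¹' G i) :=
    MeasurableSet.iInter fun i => (hpr i).measurable (hGm i)
  refine ⟨⋂ i, pr i ⁻¹' G i, hbm, ?_, ?_⟩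
  · have hexp : (ℓ : ℝ) * (8 * Real.exp (-(k * η ^ 2 / 32))) ≤ δ := by
      have a1 : Real.exp (-(k * η ^ 2 / 32)) ≤ Real.exp (-(4 * R)) :=
        Real.exp_le_exp.2 (by linarith)
      have a2 : Real.exp (-(4 * R)) = (δ / (2 * ℓ)) ^ 4 := by
        have : -(4 * R) = ((4 : ℕ) : ℝ) * (-R) := by push_cast; ring
        rw [this, Real.exp_nat_mul, hR, Real.exp_neg, Real.exp_log (by positivity), inv_div]
      set p := δ / (2 * ℓ) with hp
      have hp0 : 0 < p := by positivity
      have hp2 : p ≤ 1 / 2 := by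
        rw [hp, div_le_iff₀ (by positivity)]; nlinarith
      have hlp : ℓ * p = δ / 2 := by rw [hp]; field_simp
      have hp3 : p ^ 3 ≤ (1 / 2) ^ 3 := by gcongr
      calc (ℓ : ℝ) * (8 * Real.exp (-(k * η ^ 2 / 32))) ≤ ℓ * (8 * p ^ 4) := by
            rw [← a2]; gcongr
        _ = 8 * (ℓ * p) * p ^ 3 := by ring
        _ ≤ 8 * (ℓ * p) * (1 / 2) ^ 3 := by gcongr
        _ ≤ δ := by rw [hlp]; linarith
    have hcompl : (Measure.pi (fun _ : Fin k => Measure.pi D)) (⋂ i, pr i ⁻¹' G i)ᶜ ≤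
        ENNReal.ofReal δ := by
      rw [Set.compl_iInter]
      refine (measure_iUnion_fintype_le _ _).trans ?_
      have : ∀ i, (Measure.pi (fun _ : Fin k => Measure.pi D)) (pr i ⁻¹' G i)ᶜ ≤
          ENNReal.ofReal (8 * Real.exp (-(k * η ^ 2 / 32))) := by
        intro i
        rw [← Set.preimage_compl, (hpr i).measure_preimage (hGm i).compl.nullMeasurableSet]
        exact hGp i
      refine (Finset.sum_le_sum fun i _ => this i).trans ?_
      rw [Finset.sum_const, Finset.card_univ, Fintype.card_fin, nsmul_eq_mul,
        ← ENNReal.ofReal_natCast, ← ENNReal.ofReal_mul (by positivity)]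
      exact ENNReal.ofReal_le_ofReal hexp
    rw [ENNReal.ofReal_sub _ hδ0.le, ENNReal.ofReal_one]
    have hc := prob_compl_eq_one_sub (μ := Measure.pi (fun _ : Fin k => Measure.pi D)) hbm.compl
    rw [compl_compl] at hc
    rw [hc]
    gcongr
  · intro x hx E hE hS
    have := SIProof.hybrid (2 * η) ℓ D (fun i => empiricalMeasure k (fun t => x t i)) hD
      (fun i => SIProof.emp_prob k hk0 _) (fun i I hI => hGe i _ (Set.mem_iInter.1 hx i) I hI)
      E hE hS
    refine this.trans (le_of_eq ?_)
    rw [hη]; field_simp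
end

section
/- Let ℓ ≥ 1 and ξ ≥ 0, and for each i ∈ {1,…,ℓ} let D_i and D̂_i be probability measures on ℝ with Kolmogorov distance ||D_i − D̂_i||_K ≤ ξ. Then for every Borel single-intersecting set E ⊆ ℝ^ℓ, |(∏_{i=1}^ℓ D_i)(E) − (∏_{i=1}^ℓ D̂_i)(E)| ≤ 2ξℓ. -/
open MeasureTheory

lemma kol_Iio (μ ν : Measure ℝ) [IsProbabilityMeasure μ] [IsProbabilityMeasure ν] (ξ : ℝ)
    (h : ∀ x : ℝ, |(μ (Set.Iic x)).toReal - (ν (Set.Iic x)).toReal| ≤ ξ) (a : ℝ) :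
    |(μ (Set.Iio a)).toReal - (ν (Set.Iio a)).toReal| ≤ ξ := by
  obtain ⟨u, hu, hlt, hlim⟩ := exists_seq_strictMono_tendsto a
  have hU : (⋃ n, Set.Iic (u n)) = Set.Iio a :=
    iUnion_Iic_eq_Iio_of_lt_of_tendsto hlt hlim
  have hm : Monotone (fun n => Set.Iic (u n)) := fun i j hij =>
    Set.Iic_subset_Iic.2 (hu.monotone hij)
  have key : ∀ (ρ : Measure ℝ) [IsProbabilityMeasure ρ],
      Filter.Tendsto (fun n => (ρ (Set.Iic (u n))).toReal) Filter.atTop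
        (nhds (ρ (Set.Iio a)).toReal) := by
    intro ρ _
    have := tendsto_measure_iUnion_atTop (μ := ρ) hm
    rw [hU] at this
    exact (ENNReal.tendsto_toReal (measure_ne_top _ _)).comp this
  exact le_of_tendsto' ((key μ).sub (key ν)).abs (fun n => h (u n))

lemma lower_cases (S : Set ℝ) (hS : IsLowerSet S) :
    S = ∅ ∨ S = Set.univ ∨ (∃ a, S = Set.Iic a) ∨ (∃ a, S = Set.Iio a) := by
  by_cases he : S = ∅
  · exact Or.inl he
  by_cases hb : BddAbove S
  · have hne := Set.nonempty_iff_ne_empty.2 he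
    have hl := isLUB_csSup hne hb
    right; right
    by_cases ha : sSup S ∈ S
    · left
      exact ⟨sSup S, Set.Subset.antisymm (fun x hx => hl.1 hx) (fun x hx => hS hx ha)⟩
    · right
      refine ⟨sSup S, Set.Subset.antisymm (fun x hx => lt_of_le_of_ne (hl.1 hx) ?_) ?_⟩
      · rintro rfl; exact ha hx
      · intro x hx
        obtain ⟨y, hy, hxy⟩ := exists_lt_of_lt_csSup hne hx
        exact hS hxy.le hy
  · right; left
    rw [Set.eq_univ_iff_forall]
    intro x
    rw [not_bddAbove_iff] at hb
    obtain ⟨y, hy, hxy⟩ := hb x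
    exact hS hxy.le hy

lemma kol_lower (μ ν : Measure ℝ) [IsProbabilityMeasure μ] [IsProbabilityMeasure ν] (ξ : ℝ)
    (hξ : 0 ≤ ξ)
    (h : ∀ x : ℝ, |(μ (Set.Iic x)).toReal - (ν (Set.Iic x)).toReal| ≤ ξ)
    (S : Set ℝ) (hS : IsLowerSet S) :
    |(μ S).toReal - (ν S).toReal| ≤ ξ := by
  rcases lower_cases S hS with rfl | rfl | ⟨a, rfl⟩ | ⟨a, rfl⟩
  · simpa
  · simpa
  · exact h a
  · exact kol_Iio μ ν ξ h a

lemma kol_ordConnected (μ ν : Measure ℝ) [IsProbabilityMeasure μ] [IsProbabilityMeasure ν] (ξ : ℝ)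
    (hξ : 0 ≤ ξ)
    (h : ∀ x : ℝ, |(μ (Set.Iic x)).toReal - (ν (Set.Iic x)).toReal| ≤ ξ)
    (I : Set ℝ) (hI : I.OrdConnected) :
    |(μ I).toReal - (ν I).toReal| ≤ 2 * ξ := by
  set L : Set ℝ := {x | ∃ y ∈ I, x ≤ y} with hL
  have hIL : I ⊆ L := fun x hx => ⟨x, hx, le_rfl⟩
  have h1 : IsLowerSet L := by
    rintro a b hba ⟨y, hy, hay⟩
    exact ⟨y, hy, hba.trans hay⟩
  have h2 : IsLowerSet (L \ I) := by
    rintro a b hba ⟨⟨y, hy, hay⟩, ha⟩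
    exact ⟨⟨y, hy, hba.trans hay⟩, fun hb => ha (hI.out hb hy ⟨hba, hay⟩)⟩
  have key : ∀ (ρ : Measure ℝ) [IsProbabilityMeasure ρ],
      (ρ I).toReal = (ρ L).toReal - (ρ (L \ I)).toReal := by
    intro ρ _
    have := measureReal_sdiff (μ := ρ) hIL hI.measurableSet
    simp only [Measure.real] at this
    linarith
  rw [key μ, key ν]
  have a1 := abs_le.1 (kol_lower μ ν ξ hξ h _ h1)
  have a2 := abs_le.1 (kol_lower μ ν ξ hξ h _ h2)
  rw [abs_le]
  constructor <;> linarith [a1.1, a1.2, a2.1, a2.2]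

lemma lintegral_close {α : Type*} [MeasurableSpace α] (μ : Measure α) [IsProbabilityMeasure μ]
    (f g : α → ENNReal) (hf : Measurable f) (hg : Measurable g) (hf1 : ∀ x, f x ≤ 1)
    (hg1 : ∀ x, g x ≤ 1) (c : ℝ) (h : ∀ x, |(f x).toReal - (g x).toReal| ≤ c) :
    |(∫⁻ x, f x ∂μ).toReal - (∫⁻ x, g x ∂μ).toReal| ≤ c := by
  have key : ∀ k : α → ENNReal, Measurable k → (∀ x, k x ≤ 1) →
      Integrable (fun x => (k x).toReal) μ ∧ ∫ x, (k x).toReal ∂μ = (∫⁻ x, k x ∂μ).toReal := by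
    intro k hk hk1
    constructor
    · refine Integrable.of_bound hk.ennreal_toReal.aestronglyMeasurable 1 (.of_forall fun x => ?_)
      rw [Real.norm_of_nonneg ENNReal.toReal_nonneg]
      exact ENNReal.toReal_le_of_le_ofReal zero_le_one (by simpa using hk1 x)
    · exact integral_toReal hk.aemeasurable
        (.of_forall fun x => (hk1 x).trans_lt ENNReal.one_lt_top)
  obtain ⟨i1, e1⟩ := key f hf hf1
  obtain ⟨i2, e2⟩ := key g hg hg1
  rw [← e1, ← e2, ← integral_sub i1 i2]
  have := norm_integral_le_of_norm_le_const (μ := μ) (f := fun x => (f x).toReal - (g x).toReal)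
    (C := c) (.of_forall h)
  simpa using this

lemma si_aux (ξ : ℝ) (hξ : 0 ≤ ξ) : ∀ (ℓ : ℕ)
    (D Dhat : Fin ℓ → Measure ℝ)
    [∀ i, IsProbabilityMeasure (D i)] [∀ i, IsProbabilityMeasure (Dhat i)]
    (_ : ∀ (i : Fin ℓ) (x : ℝ),
      |((D i) (Set.Iic x)).toReal - ((Dhat i) (Set.Iic x)).toReal| ≤ ξ)
    (E : Set (Fin ℓ → ℝ)) (_ : MeasurableSet E) (_ : SingleIntersecting E),
    |((Measure.pi D) E).toReal - ((Measure.pi Dhat) E).toReal| ≤ 2 * ξ * ℓ := by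
  intro ℓ
  induction ℓ with
  | zero =>
    intro D Dhat _ _ hK E hE hsi
    have : D = Dhat := Subsingleton.elim _ _
    subst this
    simp
  | succ n ih =>
    intro D Dhat _ _ hK E hE hsi
    set e := MeasurableEquiv.piFinSuccAbove (fun _ : Fin (n+1) => ℝ) 0 with he
    set F : Set (ℝ × (Fin n → ℝ)) := e.symm ⁻¹' E with hF
    have hFm : MeasurableSet F := e.symm.measurable hE
    have key : ∀ (G : Fin (n+1) → Measure ℝ) [∀ i, IsProbabilityMeasure (G i)],
        Measure.pi G E = ((G 0).prod (Measure.pi fun j : Fin n => G j.succ)) F := by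
      intro G _
      have := (measurePreserving_piFinSuccAbove G 0).symm
      exact (this.measure_preimage_equiv E).symm
    have hmem : ∀ x y, (x, y) ∈ F ↔ (Fin.cons x y : Fin (n+1) → ℝ) ∈ E := by
      intro x y
      simp [hF, he, MeasurableEquiv.piFinSuccAbove]
      rfl
    rw [key D, key Dhat]
    set P := Measure.pi fun j : Fin n => D j.succ
    set Q := Measure.pi fun j : Fin n => Dhat j.succ
    have s1 : |(((D 0).prod P) F).toReal - (((Dhat 0).prod P) F).toReal| ≤ 2 * ξ := by
      rw [Measure.prod_apply_symm hFm, Measure.prod_apply_symm hFm]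
      refine lintegral_close _ _ _ (measurable_measure_prodMk_right hFm)
        (measurable_measure_prodMk_right hFm) (fun _ => prob_le_one) (fun _ => prob_le_one) _ ?_
      intro y
      refine kol_ordConnected _ _ ξ hξ (hK 0) _ ?_
      convert hsi 0 (Fin.cons 0 y) using 1
      ext x
      simp [hmem, Fin.update_cons_zero]
    have s2 : |(((Dhat 0).prod P) F).toReal - (((Dhat 0).prod Q) F).toReal| ≤ 2 * ξ * n := by
      rw [Measure.prod_apply hFm, Measure.prod_apply hFm]
      refine lintegral_close _ _ _ (measurable_measure_prodMk_left hFm)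
        (measurable_measure_prodMk_left hFm) (fun _ => prob_le_one) (fun _ => prob_le_one) _ ?_
      intro x
      refine ih _ _ (fun i => hK i.succ) _ (measurable_prodMk_left hFm) ?_
      intro i a
      convert hsi i.succ (Fin.cons x a) using 1
      ext z
      simp [hmem, Fin.cons_update]
    push_cast
    have := abs_sub_le (((D 0).prod P) F).toReal (((Dhat 0).prod P) F).toReal
      (((Dhat 0).prod Q) F).toReal
    linarith

/-- If the coordinate marginals `D i` and `Dhat i` are within `ξ` in
Kolmogorov distance for every `i`, then the two product measures assign to every Borel
single-intersecting set `E ⊆ ℝ^ℓ` probabilities that differ by at most `2ξℓ`. -/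
theorem singleIntersecting_product_measure_stability
    {ℓ : ℕ} (hℓ : 1 ≤ ℓ) (ξ : ℝ) (hξ : 0 ≤ ξ)
    (D Dhat : Fin ℓ → Measure ℝ)
    [∀ i, IsProbabilityMeasure (D i)] [∀ i, IsProbabilityMeasure (Dhat i)]
    (hK : ∀ (i : Fin ℓ) (x : ℝ),
      |((D i) (Set.Iic x)).toReal - ((Dhat i) (Set.Iic x)).toReal| ≤ ξ)
    (E : Set (Fin ℓ → ℝ)) (hE : MeasurableSet E) (hsi : SingleIntersecting E) :
    |((Measure.pi D) E).toReal - ((Measure.pi Dhat) E).toReal| ≤ 2 * ξ * ℓ := by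
  exact si_aux ξ hξ ℓ D Dhat hK E hE hsi
end

section
/- Let m ≥ 1 and ε ≥ 0, and for each j ∈ {1,…,m} let D_j and D̂_j be probability measures on ℝ with Kolmogorov distance ||D_j − D̂_j||_K ≤ ε. Let c_1,…,c_m ∈ ℝ. Let F be the distribution of the random variable Σ_{j=1}^m max(t_j − c_j, 0) when t = (t_1,…,t_m) is drawn from ∏_{j=1}^m D_j, and let F̂ be its distribution when t is drawn from ∏_{j=1}^m D̂_j. Then ||F − F̂||_K ≤ 2mε; that is, for every x ∈ ℝ, |Pr_{t ∼ ∏ D_j}[Σ_{j=1}^m (t_j − c_j)^+ ≤ x] − Pr_{t ∼ ∏ D̂_j}[Σ_{j=1}^m (t_j − c_j)^+ ≤ x]| ≤ 2mε. -/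
open MeasureTheory

lemma aux_prod_le {X Y : Type*} [MeasurableSpace X] [MeasurableSpace Y]
    (α : Measure X) (β γ : Measure Y) [IsProbabilityMeasure α] [IsProbabilityMeasure β]
    [IsProbabilityMeasure γ] (A : Set (X × Y)) (hA : MeasurableSet A) (δ : ℝ) (hδ : 0 ≤ δ)
    (h : ∀ a, (β (Prod.mk a ⁻¹' A)).toReal - (γ (Prod.mk a ⁻¹' A)).toReal ≤ δ) :
    ((α.prod β) A).toReal - ((α.prod γ) A).toReal ≤ δ := by
  have h1 : (α.prod β) A ≤ (α.prod γ) A + ENNReal.ofReal δ := by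
    rw [Measure.prod_apply hA, Measure.prod_apply hA]
    calc ∫⁻ a, β (Prod.mk a ⁻¹' A) ∂α
        ≤ ∫⁻ a, (γ (Prod.mk a ⁻¹' A) + ENNReal.ofReal δ) ∂α := by
          apply lintegral_mono
          intro a
          have := h a
          show β (Prod.mk a ⁻¹' A) ≤ γ (Prod.mk a ⁻¹' A) + ENNReal.ofReal δ
          rw [← ENNReal.ofReal_toReal (measure_ne_top β (Prod.mk a ⁻¹' A)),
            ← ENNReal.ofReal_toReal (measure_ne_top γ (Prod.mk a ⁻¹' A)),
            ← ENNReal.ofReal_add ENNReal.toReal_nonneg hδ]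
          apply ENNReal.ofReal_le_ofReal
          linarith
      _ = _ := by
          rw [lintegral_add_right _ measurable_const]
          simp
  have h2 := ENNReal.toReal_mono (by finiteness) h1
  rw [ENNReal.toReal_add (by finiteness) (by finiteness), ENNReal.toReal_ofReal hδ] at h2
  linarith

lemma aux_prod {X Y : Type*} [MeasurableSpace X] [MeasurableSpace Y]
    (α : Measure X) (β γ : Measure Y) [IsProbabilityMeasure α] [IsProbabilityMeasure β]
    [IsProbabilityMeasure γ] (A : Set (X × Y)) (hA : MeasurableSet A) (δ : ℝ) (hδ : 0 ≤ δ)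
    (h : ∀ a, |(β (Prod.mk a ⁻¹' A)).toReal - (γ (Prod.mk a ⁻¹' A)).toReal| ≤ δ) :
    |((α.prod β) A).toReal - ((α.prod γ) A).toReal| ≤ δ := by
  rw [abs_le]
  have h1 := aux_prod_le α β γ A hA δ hδ (fun a => (abs_le.1 (h a)).2)
  have h2 := aux_prod_le α γ β A hA δ hδ (fun a => by linarith [(abs_le.1 (h a)).1])
  constructor <;> linarith

lemma aux_prod_left {X Y : Type*} [MeasurableSpace X] [MeasurableSpace Y]
    (α : Measure X) (β γ : Measure Y) [IsProbabilityMeasure α] [IsProbabilityMeasure β]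
    [IsProbabilityMeasure γ] (A : Set (Y × X)) (hA : MeasurableSet A) (δ : ℝ) (hδ : 0 ≤ δ)
    (h : ∀ a, |(β ((fun y => (y, a)) ⁻¹' A)).toReal - (γ ((fun y => (y, a)) ⁻¹' A)).toReal| ≤ δ) :
    |((β.prod α) A).toReal - ((γ.prod α) A).toReal| ≤ δ := by
  rw [← Measure.prod_swap (μ := α) (ν := β), ← Measure.prod_swap (μ := α) (ν := γ),
    Measure.map_apply measurable_swap hA, Measure.map_apply measurable_swap hA]
  exact aux_prod α β γ _ (measurable_swap hA) δ hδ h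

lemma aux_pi_succ {n : ℕ} (D : Fin (n + 1) → Measure ℝ) [∀ j, IsProbabilityMeasure (D j)]
    (c : Fin (n + 1) → ℝ) (x : ℝ) :
    (Measure.pi D) {t | (∑ j, max (t j - c j) 0) ≤ x} =
      ((D 0).prod (Measure.pi fun j : Fin n => D j.succ))
        {p | max (p.1 - c 0) 0 + (∑ j : Fin n, max (p.2 j - c j.succ) 0) ≤ x} := by
  have h := (measurePreserving_piFinSuccAbove D 0).measure_preimage_equiv
    {p | max (p.1 - c 0) 0 + (∑ j : Fin n, max (p.2 j - c j.succ) 0) ≤ x}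
  simp only [Fin.succAbove_zero] at h
  rw [← h]
  congr 1
  ext t
  simp [Fin.sum_univ_succ, MeasurableEquiv.piFinSuccAbove, Fin.insertNthEquiv, Fin.tail]

lemma aux_main (ε : ℝ) (hε : 0 ≤ ε) : ∀ (m : ℕ)
    (D Dhat : Fin m → Measure ℝ)
    [∀ j, IsProbabilityMeasure (D j)] [∀ j, IsProbabilityMeasure (Dhat j)]
    (_ : ∀ (j : Fin m) (y : ℝ),
      |((D j) (Set.Iic y)).toReal - ((Dhat j) (Set.Iic y)).toReal| ≤ ε)
    (c : Fin m → ℝ) (x : ℝ),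
      |((Measure.pi D) {t | (∑ j, max (t j - c j) 0) ≤ x}).toReal -
        ((Measure.pi Dhat) {t | (∑ j, max (t j - c j) 0) ≤ x}).toReal| ≤ m * ε := by
  intro m
  induction m with
  | zero =>
    intro D Dhat _ _ _ c x
    have : D = Dhat := Subsingleton.elim _ _
    subst this
    simp
  | succ n ih =>
    intro D Dhat _ _ hK c x
    rw [aux_pi_succ D, aux_pi_succ Dhat]
    set A : Set (ℝ × (Fin n → ℝ)) :=
      {p | max (p.1 - c 0) 0 + (∑ j : Fin n, max (p.2 j - c j.succ) 0) ≤ x} with hAdef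
    have hA : MeasurableSet A := by
      apply measurableSet_le _ measurable_const
      fun_prop
    have h1 := aux_prod_left (Measure.pi fun j : Fin n => D j.succ) (D 0) (Dhat 0) A hA ε hε (by
      intro b
      by_cases hb : (∑ j : Fin n, max (b j - c j.succ) 0) ≤ x
      · have : (fun y => (y, b)) ⁻¹' A
            = Set.Iic (x - (∑ j : Fin n, max (b j - c j.succ) 0) + c 0) := by
          ext y
          simp only [hAdef, Set.mem_preimage, Set.mem_setOf_eq, Set.mem_Iic]
          rw [← le_sub_iff_add_le, max_le_iff]
          constructor
          · rintro ⟨h, _⟩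
            linarith
          · intro h
            constructor <;> linarith
        rw [this]
        exact hK 0 _
      · have : (fun y => (y, b)) ⁻¹' A = ∅ := by
          ext y
          simp only [hAdef, Set.mem_preimage, Set.mem_setOf_eq, Set.mem_empty_iff_false,
            iff_false]
          intro h
          apply hb
          linarith [le_max_right (y - c 0) 0]
        rw [this]
        simpa using hε)
    have h2 := aux_prod (Dhat 0) (Measure.pi fun j : Fin n => D j.succ)
      (Measure.pi fun j : Fin n => Dhat j.succ) A hA (n * ε) (by positivity) (by
      intro a
      have : Prod.mk a ⁻¹' A
          = {t | (∑ j : Fin n, max (t j - c j.succ) 0) ≤ x - max (a - c 0) 0} := by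
        ext t
        simp only [hAdef, Set.mem_preimage, Set.mem_setOf_eq]
        constructor <;> intro h <;> linarith
      rw [this]
      exact ih (fun j => D j.succ) (fun j => Dhat j.succ) (fun j y => hK j.succ y)
        (fun j => c j.succ) _)
    refine (abs_sub_le _ _ _).trans ((add_le_add h1 h2).trans ?_)
    push_cast
    linarith

/-- If the item marginals `D j` and `Dhat j` are within `ε` in Kolmogorov
distance, then for any constants `c j`, the distributions of `∑ j, (t j - c j)⁺` under the two
product measures are within `2mε` in Kolmogorov distance. -/
theorem utility_distribution_kolmogorov_stability
    {m : ℕ} (hm : 1 ≤ m) (ε : ℝ) (hε : 0 ≤ ε)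
    (D Dhat : Fin m → Measure ℝ)
    [∀ j, IsProbabilityMeasure (D j)] [∀ j, IsProbabilityMeasure (Dhat j)]
    (hK : ∀ (j : Fin m) (y : ℝ),
      |((D j) (Set.Iic y)).toReal - ((Dhat j) (Set.Iic y)).toReal| ≤ ε)
    (c : Fin m → ℝ) :
    ∀ x : ℝ,
      |((Measure.pi D) {t | (∑ j, max (t j - c j) 0) ≤ x}).toReal -
        ((Measure.pi Dhat) {t | (∑ j, max (t j - c j) 0) ≤ x}).toReal| ≤ 2 * m * ε := by
  intro x
  refine (aux_main ε hε m D Dhat hK c x).trans ?_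
  have : 0 ≤ (m : ℝ) * ε := by positivity
  linarith
end
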